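/- Main Theorem (linear-system form). Let k be a field of characteristic ≠ 2 and let q_0, q_1, …, q_M be quadratic forms on k^(N+1). Then there exist natural numbers m, n and units a_1, …, a_n of k(x_1, …, x_m) such that for every field extension L/k the following are equivalent: (a) the n-fold Pfister form ⟨⟨a_1, …, a_n⟩⟩ is isotropic over L(x_1, …, x_m) (the a_i transported along the canonical embedding k(x_1, …, x_m) → L(x_1, …, x_m)); (b) there exist a finite field extension L'/L of odd degree and a nonzero vector v ∈ L'^(N+1) with q_i(v) = 0 for every i = 0, …, M. -/

import Mathlib

noncomputable section

open scoped BigOperators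

/-- A quadratic form is *isotropic* if it vanishes on some nonzero vector. -/
def QuadraticMap.IsIsotropic {R M : Type*} [CommSemiring R] [AddCommMonoid M] [Module R M]
    (q : QuadraticForm R M) : Prop :=
  ∃ v, v ≠ 0 ∧ q v = 0

/-- `p` is a subform of `q` -/
def QuadraticMap.IsSubform {R M₁ M₂ : Type*} [CommSemiring R] [AddCommMonoid M₁]
    [AddCommMonoid M₂] [Module R M₁] [Module R M₂]
    (p : QuadraticForm R M₁) (q : QuadraticForm R M₂) : Prop :=
  ∃ f : M₁ →ₗ[R] M₂, Function.Injective f ∧ ∀ v, q (f v) = p v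

/-- Base change of a quadratic form on `k^n` along a ring homomorphism `f : k →+* E`:
the quadratic form on `E^n` whose values on the standard basis vectors, and whose polar
values on pairs of standard basis vectors, are the images under `f` of those of `q`. -/
def QuadraticForm.mapAlong {k E : Type*} [CommRing k] [CommRing E] (f : k →+* E) {n : ℕ}
    (q : QuadraticForm k (Fin n → k)) : QuadraticForm E (Fin n → E) :=
  Matrix.toQuadraticMap' (Matrix.of fun i j =>
    if i = j then f (q (Pi.single i 1))
    else if i < j then f (QuadraticMap.polar ⇑q (Pi.single i 1) (Pi.single j 1)) else 0)

/-- The `n`-fold Pfister form `⟨⟨a_1, …, a_n⟩⟩`: the diagonal quadratic form of rank `2^n`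
whose diagonal entries, indexed by the subsets `S ⊆ {1, …, n}`, are `∏_{i ∈ S} (-a_i)`. -/
def PfisterForm {F : Type*} [Field F] {n : ℕ} (a : Fin n → F) :
    QuadraticForm F (Finset (Fin n) → F) :=
  QuadraticMap.weightedSumSquares F (fun S : Finset (Fin n) => ∏ i ∈ S, (-a i))

/-- The canonical ring embedding of `F` into `F(x_1, …, x_m)`. -/
def toFrac (F : Type*) [Field F] (m : ℕ) : F →+* FractionRing (MvPolynomial (Fin m) F) :=
  (algebraMap (MvPolynomial (Fin m) F) (FractionRing (MvPolynomial (Fin m) F))).comp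
    MvPolynomial.C

/-- The canonical embedding `F(x_1, …, x_m) → L(x_1, …, x_m)` induced by `F → L`. -/
def transMap (F L : Type*) [Field F] [Field L] [Algebra F L] (m : ℕ) :
    FractionRing (MvPolynomial (Fin m) F) →+* FractionRing (MvPolynomial (Fin m) L) :=
  IsFractionRing.lift (g := (algebraMap (MvPolynomial (Fin m) L)
      (FractionRing (MvPolynomial (Fin m) L))).comp (MvPolynomial.map (algebraMap F L)))
    (((IsFractionRing.injective (MvPolynomial (Fin m) L)
        (FractionRing (MvPolynomial (Fin m) L))).comp
      (MvPolynomial.map_injective _ (algebraMap F L).injective)))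

/-- The generic value `p(X)` of a quadratic form `p` on `k^n`: the value of the base change
of `p` to `k(X_1, …, X_n)` at the vector of indeterminates. -/
def genericValue {k : Type*} [Field k] {n : ℕ} (p : QuadraticForm k (Fin n → k)) :
    FractionRing (MvPolynomial (Fin n) k) :=
  (p.mapAlong (toFrac k n)) fun i =>
    algebraMap (MvPolynomial (Fin n) k) (FractionRing (MvPolynomial (Fin n) k))
      (MvPolynomial.X i)

/-- `E` is a finite extension of odd degree of `F`, via the ring homomorphism `f`. -/
def IsOddFiniteExt (F E : Type*) [Field F] [Field E] (f : F →+* E) : Prop :=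
  letI : Algebra F E := f.toAlgebra
  FiniteDimensional F E ∧ Odd (Module.finrank F E)

universe u

namespace Ring.NormalClosure
section
variable (R S : Type*) [CommRing R] [CommRing S] [IsDomain R] [IsDomain S]
  [Algebra R S] [Module.IsTorsionFree R S]

local instance : Algebra (FractionRing R) (FractionRing S) := FractionRing.liftAlgebra _ _

local notation "𝓚" => FractionRing R
local notation "𝓛" => FractionRing S
local notation "𝓔" => IntermediateField.normalClosure 𝓚 𝓛 (AlgebraicClosure 𝓛)

local instance : Algebra S 𝓔 := ((algebraMap 𝓛 𝓔).comp (algebraMap S 𝓛)).toAlgebra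
local instance : IsScalarTower S 𝓛 𝓔 := IsScalarTower.of_algebraMap_eq' rfl
local notation "𝓣" => NormalClosure R S
local instance : Algebra 𝓣 𝓔 := inferInstanceAs (Algebra (integralClosure S 𝓔) 𝓔)
local instance : IsScalarTower S 𝓣 𝓔 :=
  inferInstanceAs (IsScalarTower S (integralClosure S 𝓔) 𝓔)
local instance : IsIntegralClosure 𝓣 S 𝓔 := integralClosure.isIntegralClosure S 𝓔
local instance : IsScalarTower R 𝓛 𝓔 := IsScalarTower.to₁₃₄ R 𝓚 𝓛 𝓔
local instance : IsScalarTower R S 𝓔 := IsScalarTower.to₁₂₄ R S 𝓛 𝓔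
local instance : IsScalarTower R 𝓣 𝓔 := IsScalarTower.to₁₃₄ R S 𝓣 𝓔

theorem isSeparable_normalClosure [Algebra.IsSeparable (FractionRing R) (FractionRing S)] :
    Algebra.IsSeparable 𝓚 𝓔 := by
  have h : 𝓔 ≤ separableClosure 𝓚 (AlgebraicClosure 𝓛) := by
    refine iSup_le fun i => ?_
    have : Algebra.IsSeparable 𝓚 i.fieldRange :=
      (AlgEquiv.Algebra.isSeparable (AlgEquiv.ofInjectiveField i))
    exact le_separableClosure 𝓚 (AlgebraicClosure 𝓛) _
  exact Algebra.IsSeparable.of_algHom 𝓚 (separableClosure 𝓚 (AlgebraicClosure 𝓛))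
    (IntermediateField.inclusion h)

variable [Module.Finite R S]
local instance : FiniteDimensional 𝓛 𝓔 := Module.Finite.right 𝓚 𝓛 𝓔

theorem isFractionRing_normalClosure : IsFractionRing 𝓣 𝓔 :=
  integralClosure.isFractionRing_of_finite_extension (A := S) 𝓛 𝓔

attribute [local instance] isFractionRing_normalClosure

variable [Algebra.IsSeparable (FractionRing R) (FractionRing S)]

theorem isGalois_of_isSeparable : IsGalois 𝓚 (FractionRing 𝓣) := by
  have := isSeparable_normalClosure R S
  have : IsGalois 𝓚 𝓔 := ⟨⟩
  refine IsGalois.of_equiv_equiv (F := 𝓚) (E := 𝓔)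
    (f := (FractionRing.algEquiv R 𝓚).symm.toRingEquiv)
    (g := (FractionRing.algEquiv 𝓣 𝓔).symm.toRingEquiv) ?_
  ext
  simpa using! IsFractionRing.algEquiv_commutes (FractionRing.algEquiv R 𝓚).symm
    (FractionRing.algEquiv 𝓣 𝓔).symm _

variable [IsDedekindDomain S]
set_option linter.overlappingInstances false

theorem finite_of_isSeparable : Module.Finite S 𝓣 :=
  have := isSeparable_normalClosure R S
  have : Algebra.IsSeparable 𝓛 𝓔 := Algebra.isSeparable_tower_top_of_isSeparable 𝓚 𝓛 𝓔
  IsIntegralClosure.finite S 𝓛 𝓔 𝓣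

theorem isDedekindDomain_of_isSeparable : IsDedekindDomain 𝓣 :=
  have := isSeparable_normalClosure R S
  have : Algebra.IsSeparable 𝓛 𝓔 := Algebra.isSeparable_tower_top_of_isSeparable 𝓚 𝓛 𝓔
  integralClosure.isDedekindDomain S 𝓛 𝓔
end
end Ring.NormalClosure

attribute [local instance] FractionRing.liftAlgebra in
theorem Ideal.relNorm_eq_pow_of_isSeparable {R S : Type*} [CommRing R] [CommRing S]
    [IsDedekindDomain R] [IsDedekindDomain S] [Algebra R S] [Module.IsTorsionFree R S]
    [Module.Finite R S] [Algebra.IsSeparable (FractionRing R) (FractionRing S)]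
    (P : Ideal S) (p : Ideal R) [P.LiesOver p] [P.IsMaximal] [p.IsMaximal] :
    Ideal.relNorm R P = p ^ P.inertiaDeg R := by
  let T := Ring.NormalClosure R S
  have : Module.Finite S T := Ring.NormalClosure.finite_of_isSeparable R S
  have : Module.Finite R T := Module.Finite.trans S T
  have : IsDedekindDomain T := Ring.NormalClosure.isDedekindDomain_of_isSeparable R S
  have : IsGalois (FractionRing R) (FractionRing T) :=
    Ring.NormalClosure.isGalois_of_isSeparable R S
  obtain ⟨Q, hQ₁, hQ₂⟩ : ∃ Q : Ideal T, Q.IsMaximal ∧ Q.LiesOver P :=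
    Ideal.exists_maximal_ideal_liesOver_of_isIntegral P
  have : Q.LiesOver p := Ideal.LiesOver.trans Q P p
  have h := Ideal.relNorm_eq_pow_of_isPrime_isGalois Q p
  have : IsGalois (FractionRing S) (FractionRing T) :=
    IsGalois.tower_top_of_isGalois (FractionRing R) (FractionRing S) (FractionRing T)
  rwa [← Ideal.relNorm_relNorm R S, Ideal.relNorm_eq_pow_of_isPrime_isGalois Q P, map_pow,
    Ideal.inertiaDeg_tower (R := R) P Q, pow_mul,
    pow_left_inj (Ideal.inertiaDeg_pos Q S).ne'] at h

open UniqueFactorizationMonoid in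
open scoped Classical in
attribute [local instance] FractionRing.liftAlgebra in
theorem Ideal.exists_odd_inertiaDeg_of_odd_count_relNorm {R S : Type*} [CommRing R] [CommRing S]
    [IsDedekindDomain R] [IsDedekindDomain S] [Algebra R S] [Module.IsTorsionFree R S]
    [Module.Finite R S] [Algebra.IsSeparable (FractionRing R) (FractionRing S)]
    (p : Ideal R) [p.IsMaximal] (I : Ideal S) (hI : I ≠ ⊥)
    (hodd : Odd ((normalizedFactors (Ideal.relNorm R I)).count p)) :
    ∃ P : Ideal S, P.IsMaximal ∧ P.LiesOver p ∧ Odd (P.inertiaDeg R) ∧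
      Odd ((normalizedFactors I).count P) := by
  have key : ∀ s : Multiset (Ideal S), (∀ P ∈ s, P ≠ ⊥) →
      (normalizedFactors (Ideal.relNorm R s.prod)).count p =
        (s.map fun P => (normalizedFactors (Ideal.relNorm R P)).count p).sum := by
    intro s
    induction s using Multiset.induction_on with
    | empty => rw [Multiset.prod_zero, map_one, normalizedFactors_one]; simp
    | cons P s ih =>
      intro h
      have h1 : Ideal.relNorm R P ≠ 0 := by
        simpa [Ideal.relNorm_eq_bot_iff] using h P (Multiset.mem_cons_self _ _)
      have h2 : Ideal.relNorm R s.prod ≠ 0 := by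
        have : s.prod ≠ 0 := Multiset.prod_ne_zero fun h0 =>
          h 0 (Multiset.mem_cons_of_mem h0) rfl
        simpa [Ideal.relNorm_eq_bot_iff] using this
      rw [Multiset.prod_cons, map_mul, normalizedFactors_mul h1 h2, Multiset.count_add,
        ih fun Q hQ => h Q (Multiset.mem_cons_of_mem hQ), Multiset.map_cons, Multiset.sum_cons]
  have hmem : ∀ P ∈ normalizedFactors I, P ≠ ⊥ ∧ P.IsPrime := fun P hP =>
    have hP' := prime_of_normalized_factor P hP
    ⟨hP'.ne_zero, Ideal.isPrime_of_prime hP'⟩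
  rw [← associated_iff_eq.1 (prod_normalizedFactors hI), key _ fun P hP => (hmem P hP).1,
    Finset.sum_multiset_map_count] at hodd
  obtain ⟨P, hP, hPodd⟩ : ∃ P ∈ (normalizedFactors I).toFinset, Odd ((normalizedFactors I).count P •
      (normalizedFactors (Ideal.relNorm R P)).count p) := by
    by_contra! h
    exact (Nat.not_even_iff_odd.2 hodd)
      (Finset.even_sum _ fun P hP => Nat.not_odd_iff_even.1 (h P hP))
  obtain ⟨hPbot, hPprime⟩ := hmem P (Multiset.mem_toFinset.1 hP)
  have hPmax : P.IsMaximal := hPprime.isMaximal hPbot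
  have hcmax : (P.under R).IsMaximal := Ideal.isMaximal_comap_of_isIntegral_of_isMaximal P
  rw [Ideal.relNorm_eq_pow_of_isSeparable P (P.under R), normalizedFactors_pow,
    Multiset.count_nsmul, smul_eq_mul, Nat.odd_mul, Nat.odd_mul] at hPodd
  obtain ⟨h1, h2, h3⟩ := hPodd
  have hc0 : P.under R ≠ ⊥ := by
    intro h
    rw [h, ← Ideal.zero_eq_bot, normalizedFactors_zero, Multiset.count_zero] at h3
    exact absurd h3 (by decide)
  have hirr : Irreducible (P.under R) :=
    (Ideal.prime_of_isPrime hc0 hcmax.isPrime).irreducible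
  rw [normalizedFactors_irreducible hirr, normalize_eq, Multiset.count_singleton] at h3
  have hpe : p = P.under R := by
    by_contra h
    rw [if_neg h] at h3
    simp at h3
  exact ⟨P, hPmax, ⟨hpe⟩, h2, h1⟩

open UniqueFactorizationMonoid in
open scoped Classical in
theorem Ideal.count_normalizedFactors_mul {A : Type*} [CommRing A] [IsDedekindDomain A]
    (P : Ideal A) {I J : Ideal A} (hI : I ≠ 0) (hJ : J ≠ 0) :
    (normalizedFactors (I * J)).count P =
      (normalizedFactors I).count P + (normalizedFactors J).count P := by
  rw [normalizedFactors_mul hI hJ, Multiset.count_add]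

open UniqueFactorizationMonoid in
open scoped Classical in
theorem Ideal.count_normalizedFactors_pow {A : Type*} [CommRing A] [IsDedekindDomain A]
    (P I : Ideal A) (m : ℕ) :
    (normalizedFactors (I ^ m)).count P = m * (normalizedFactors I).count P := by
  rw [normalizedFactors_pow, Multiset.count_nsmul]

open UniqueFactorizationMonoid nonZeroDivisors in
/-- If the norm of `h` has odd valuation at a prime `π` of a principal ideal domain, then some
prime of the integral extension above `π` has odd inertia degree and `h` has odd valuation
there; in particular it contains every integral element in the square class of `h`. -/
theorem exists_isMaximal_odd_inertiaDeg {R S K E : Type*} [CommRing R] [CommRing S]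
    [IsDomain R] [IsPrincipalIdealRing R] [IsDedekindDomain S] [Algebra R S]
    [Module.IsTorsionFree R S]
    [Module.Finite R S] [Field K] [Field E] [Algebra R K] [Algebra S E] [Algebra K E]
    [Algebra R E] [IsScalarTower R K E] [IsScalarTower R S E]
    [IsFractionRing R K] [IsFractionRing S E] [FiniteDimensional K E] [Algebra.IsSeparable K E]
    {π : R} (hπ : Prime π) {h : E} {a b : R} {n : ℕ} (hn : Odd n) (ha : ¬ π ∣ a) (hb : b ≠ 0)
    (hh : Algebra.norm K h * algebraMap R K b ^ 2 = algebraMap R K (π ^ n * a)) :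
    ∃ P : Ideal S, P.IsMaximal ∧ P.LiesOver (Ideal.span {π}) ∧ Odd (P.inertiaDeg R) ∧
      ∀ (g : S) (c : E), h = algebraMap S E g * c ^ 2 → g ∈ P := by
  classical
  let := FractionRing.liftAlgebra R (FractionRing S)
  have hsep : Algebra.IsSeparable (FractionRing R) (FractionRing S) := by
    refine Algebra.IsSeparable.of_equiv_equiv (FractionRing.algEquiv R K).symm.toRingEquiv
      (FractionRing.algEquiv S E).symm.toRingEquiv ?_
    ext
    simpa using! IsFractionRing.algEquiv_commutes (FractionRing.algEquiv R K).symm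
      (FractionRing.algEquiv S E).symm _
  have hmax : (Ideal.span {π}).IsMaximal :=
    PrincipalIdealRing.isMaximal_of_irreducible hπ.irreducible
  have hinjR : Function.Injective (algebraMap R K) := IsFractionRing.injective R K
  have hinjS : Function.Injective (algebraMap S E) := IsFractionRing.injective S E
  have ha0 : a ≠ 0 := fun h0 => ha (h0 ▸ dvd_zero _)
  have hh0 : h ≠ 0 := by
    rintro rfl
    rw [Algebra.norm_zero, zero_mul, eq_comm, map_eq_zero_iff _ hinjR] at hh
    exact mul_ne_zero (pow_ne_zero _ hπ.ne_zero) ha0 hh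
  obtain ⟨x, s, hs, rfl⟩ := IsFractionRing.div_surjective (A := S) h
  have hs0 : s ≠ 0 := nonZeroDivisors.ne_zero hs
  have hx0 : x ≠ 0 := by rintro rfl; simp at hh0
  have hs0' : algebraMap S E s ≠ 0 := by simpa using hs0
  have hxs : algebraMap S E (x * s) =
      (algebraMap S E x / algebraMap S E s) * algebraMap S E s ^ 2 := by
    rw [map_mul]; field_simp
  have hI0 : Ideal.span {x * s} ≠ (⊥ : Ideal S) := by simp [hx0, hs0]
  have hnorm : Algebra.intNorm R S (x * s) * b ^ 2 = π ^ n * a * Algebra.intNorm R S s ^ 2 := by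
    apply hinjR
    rw [map_mul (algebraMap R K), map_mul (algebraMap R K),
      Algebra.algebraMap_intNorm (A := R) (K := K) (L := E) (B := S), hxs,
      map_mul, map_pow, map_pow, map_pow, ← hh,
      Algebra.algebraMap_intNorm (A := R) (K := K) (L := E) (B := S)]
    ring
  have hNs : Algebra.intNorm R S s ≠ 0 := by
    rw [Ne, ← map_eq_zero_iff _ hinjR,
      Algebra.algebraMap_intNorm (A := R) (K := K) (L := E) (B := S),
      Algebra.norm_eq_zero_iff]
    exact hs0'
  have hNxs : Algebra.intNorm R S (x * s) ≠ 0 := by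
    rw [Ne, ← map_eq_zero_iff _ hinjR,
      Algebra.algebraMap_intNorm (A := R) (K := K) (L := E) (B := S),
      Algebra.norm_eq_zero_iff]
    simp [hs0, hx0]
  have hodd : Odd ((normalizedFactors (Ideal.relNorm R (Ideal.span {x * s}))).count
      (Ideal.span {π})) := by
    have h1 := congrArg (fun r => (normalizedFactors (Ideal.span {r})).count (Ideal.span {π})) hnorm
    simp only [← Ideal.span_singleton_mul_span_singleton, ← Ideal.span_singleton_pow] at h1
    have e : ∀ r : R, r ≠ 0 → Ideal.span {r} ≠ (0 : Ideal R) := fun r hr => by simpa using hr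
    rw [Ideal.count_normalizedFactors_mul _ (e _ hNxs) (pow_ne_zero _ (e _ hb)),
      Ideal.count_normalizedFactors_mul _ (mul_ne_zero (pow_ne_zero _ (e _ hπ.ne_zero)) (e _ ha0))
        (pow_ne_zero _ (e _ hNs)),
      Ideal.count_normalizedFactors_mul _ (pow_ne_zero _ (e _ hπ.ne_zero)) (e _ ha0),
      Ideal.count_normalizedFactors_pow, Ideal.count_normalizedFactors_pow,
      Ideal.count_normalizedFactors_pow] at h1
    have h2 : (normalizedFactors (Ideal.span {π})).count (Ideal.span {π}) = 1 := by
      have hirr : Irreducible (Ideal.span {π}) :=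
        (Ideal.prime_of_isPrime (e _ hπ.ne_zero) hmax.isPrime).irreducible
      rw [normalizedFactors_irreducible hirr, normalize_eq, Multiset.count_singleton_self]
    have h3 : (normalizedFactors (Ideal.span {a})).count (Ideal.span {π}) = 0 := by
      rw [Multiset.count_eq_zero]
      intro hmem
      have := dvd_of_mem_normalizedFactors hmem
      rw [Ideal.dvd_span_singleton, Ideal.mem_span_singleton] at this
      exact ha this
    rw [h2, h3] at h1
    rw [Ideal.relNorm_singleton]
    rcases hn with ⟨n', rfl⟩
    rw [Nat.odd_iff]
    omega
  obtain ⟨P, hPmax, hPover, hPdeg, hPodd⟩ :=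
    Ideal.exists_odd_inertiaDeg_of_odd_count_relNorm (Ideal.span {π}) _ hI0 hodd
  refine ⟨P, hPmax, hPover, hPdeg, fun g c hgc => ?_⟩
  by_cases hg0 : g = 0
  · rw [hg0]; exact P.zero_mem
  obtain ⟨y, z, hz, rfl⟩ := IsFractionRing.div_surjective (A := S) c
  have hz0 : z ≠ 0 := nonZeroDivisors.ne_zero hz
  have hz0' : algebraMap S E z ≠ 0 := by simpa using hz0
  have hy0 : y ≠ 0 := by
    rintro rfl
    rw [hgc] at hh0
    simp at hh0
  have heq : (x * s) * z ^ 2 = g * (y * s) ^ 2 := by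
    apply hinjS
    rw [map_mul, hxs, hgc]
    simp only [map_mul, map_pow]
    field_simp
  have h1 := congrArg (fun r => (normalizedFactors (Ideal.span {r})).count P) heq
  simp only [← Ideal.span_singleton_mul_span_singleton (g), ← Ideal.span_singleton_pow,
    ← Ideal.span_singleton_mul_span_singleton (x * s)] at h1
  have e : ∀ r : S, r ≠ 0 → Ideal.span {r} ≠ (0 : Ideal S) := fun r hr => by simpa using hr
  rw [Ideal.count_normalizedFactors_mul _ hI0 (pow_ne_zero _ (e _ hz0)),
    Ideal.count_normalizedFactors_mul _ (e _ hg0) (pow_ne_zero _ (e _ (mul_ne_zero hy0 hs0))),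
    Ideal.count_normalizedFactors_pow, Ideal.count_normalizedFactors_pow] at h1
  have h2 : (normalizedFactors (Ideal.span {g})).count P ≠ 0 := by
    rw [Nat.odd_iff] at hPodd
    omega
  rw [← Ideal.dvd_span_singleton]
  exact dvd_of_mem_normalizedFactors (Multiset.count_ne_zero.1 h2)

open nonZeroDivisors in
/-- A nonzero vector over the fraction field of a Dedekind domain can be rescaled to be integral
and nonzero modulo a given maximal ideal. -/
theorem exists_scaling_integral_of_isMaximal {S E ι : Type*} [CommRing S] [IsDedekindDomain S]
    [Field E] [Algebra S E] [IsFractionRing S E] [Finite ι] (P : Ideal S) [P.IsMaximal]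
    (v : ι → E) (hv : v ≠ 0) :
    ∃ (c : E) (w : ι → S), c ≠ 0 ∧ (∀ i, algebraMap S E (w i) = c * v i) ∧ ∃ i, w i ∉ P := by
  classical
  have hinjS : Function.Injective (algebraMap S E) := IsFractionRing.injective S E
  obtain ⟨b, hb⟩ := IsLocalization.exist_integer_multiples_of_finite S⁰ v
  choose w0 hw0 using hb
  have hb0 : algebraMap S E b ≠ 0 := by simp
  have hw0' : ∀ i, algebraMap S E (w0 i) = algebraMap S E b * v i := fun i => by
    rw [hw0 i, Algebra.smul_def]
  let I : Ideal S := Ideal.span (Set.range w0)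
  have hI : I ≠ 0 := by
    obtain ⟨i, hi⟩ := Function.ne_iff.1 hv
    intro h
    have : w0 i ∈ (0 : Ideal S) := h ▸ Ideal.subset_span ⟨i, rfl⟩
    rw [Ideal.zero_eq_bot, Ideal.mem_bot] at this
    have h2 := hw0' i
    rw [this, map_zero, eq_comm, mul_eq_zero] at h2
    exact h2.elim hb0 hi
  have hmulinv := FractionalIdeal.coe_ideal_mul_inv (K := E) I hI
  have hIne : (I : FractionalIdeal S⁰ E) ≠ 0 := FractionalIdeal.coeIdeal_ne_zero.2 hI
  obtain ⟨c, hc, i, hi⟩ : ∃ c ∈ (I : FractionalIdeal S⁰ E)⁻¹, ∃ i, ∀ r ∈ P,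
      algebraMap S E r ≠ c * algebraMap S E (w0 i) := by
    by_contra! H
    have : (I : FractionalIdeal S⁰ E) * (I : FractionalIdeal S⁰ E)⁻¹ ≤
        (P : FractionalIdeal S⁰ E) := by
      rw [FractionalIdeal.mul_le]
      intro x hx c hc
      rw [FractionalIdeal.mem_coeIdeal] at hx
      obtain ⟨x, hx, rfl⟩ := hx
      induction hx using Submodule.span_induction with
      | mem x hx =>
        obtain ⟨i, rfl⟩ := hx
        obtain ⟨r, hr, h⟩ := H c hc i
        rw [mul_comm, ← h]
        exact FractionalIdeal.mem_coeIdeal_of_mem _ hr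
      | zero => rw [map_zero, zero_mul]; exact FractionalIdeal.zero_mem _
      | add x y _ _ hx hy => rw [map_add, add_mul]; exact Submodule.add_mem _ hx hy
      | smul a x _ hx =>
        rw [smul_eq_mul, map_mul, mul_assoc, ← Algebra.smul_def]
        exact Submodule.smul_mem _ a hx
    rw [hmulinv, ← FractionalIdeal.coeIdeal_top, FractionalIdeal.coeIdeal_le_coeIdeal] at this
    exact Ideal.IsPrime.ne_top' (top_le_iff.1 this)
  have hex : ∀ j, ∃ r : S, algebraMap S E r = c * algebraMap S E (w0 j) := by
    intro j
    have := (FractionalIdeal.mem_inv_iff hIne).1 hc (algebraMap S E (w0 j))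
      (FractionalIdeal.mem_coeIdeal_of_mem _ (Ideal.subset_span ⟨j, rfl⟩))
    exact (FractionalIdeal.mem_one_iff _).1 this
  choose w hw using hex
  refine ⟨c * algebraMap S E b, w, mul_ne_zero ?_ hb0, fun j => ?_, i, fun hmem => hi _ hmem (hw i)⟩
  · rintro rfl
    exact hi 0 P.zero_mem (by simp)
  · rw [hw, hw0']; ring

/-- The value `vᵀ A v` of the quadratic form with (not necessarily symmetric) matrix `A`. -/
def qval {ι R : Type*} [Fintype ι] [CommRing R] (A : Matrix ι ι R) (v : ι → R) : R :=
  v ⬝ᵥ A.mulVec v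

section qval
variable {ι R R' : Type*} [Fintype ι] [CommRing R] [CommRing R']

theorem map_qval (f : R →+* R') (A : Matrix ι ι R) (v : ι → R) :
    f (qval A v) = qval (A.map f) (f ∘ v) := by
  have h : f ∘ A.mulVec v = (A.map f).mulVec (f ∘ v) := funext fun i => RingHom.map_mulVec f A v i
  rw [qval, RingHom.map_dotProduct, h, qval]

theorem qval_add (A B : Matrix ι ι R) (v : ι → R) : qval (A + B) v = qval A v + qval B v := by
  simp [qval, Matrix.add_mulVec, dotProduct_add]

theorem qval_smul (c : R) (A : Matrix ι ι R) (v : ι → R) : qval (c • A) v = c * qval A v := by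
  simp [qval, Matrix.smul_mulVec, dotProduct_smul]

theorem qval_smul_vec (c : R) (A : Matrix ι ι R) (v : ι → R) :
    qval A (c • v) = c ^ 2 * qval A v := by
  simp [qval, Matrix.mulVec_smul, dotProduct_smul, smul_dotProduct]; ring

theorem qval_zero_vec (A : Matrix ι ι R) : qval A 0 = 0 := by
  simp [qval]

theorem qval_sum {κ : Type*} (s : Finset κ) (A : κ → Matrix ι ι R) (v : ι → R) :
    qval (∑ i ∈ s, A i) v = ∑ i ∈ s, qval (A i) v := by
  simp [qval, Matrix.sum_mulVec, dotProduct_sum]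

end qval

/-- The matrices in `S` have a common nontrivial zero over `E`. -/
def RatZero {ι E : Type*} [Fintype ι] [CommRing E] (S : Set (Matrix ι ι E)) : Prop :=
  ∃ v : ι → E, v ≠ 0 ∧ ∀ A ∈ S, qval A v = 0

/-- The matrices in `S` have a common nontrivial zero over an odd degree extension of `E`. -/
def OddZero {ι : Type*} {E : Type u} [Fintype ι] [Field E] (S : Set (Matrix ι ι E)) : Prop :=
  ∃ (E' : Type u) (_ : Field E') (f : E →+* E'), IsOddFiniteExt E E' f ∧
    ∃ v : ι → E', v ≠ 0 ∧ ∀ A ∈ S, qval (A.map f) v = 0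

theorem IsOddFiniteExt.of_algebra (F E : Type*) [Field F] [Field E] [Algebra F E]
    [FiniteDimensional F E] (h : Odd (Module.finrank F E)) :
    IsOddFiniteExt F E (algebraMap F E) := by
  have e : (algebraMap F E).toAlgebra = ‹Algebra F E› := Algebra.algebra_ext _ _ fun _ => rfl
  unfold IsOddFiniteExt
  rw [e]
  exact ⟨‹_›, h⟩

theorem IsOddFiniteExt.comp {F E G : Type*} [Field F] [Field E] [Field G] {f : F →+* E}
    {g : E →+* G} (hg : IsOddFiniteExt E G g) (hf : IsOddFiniteExt F E f) :
    IsOddFiniteExt F G (g.comp f) := by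
  let : Algebra F E := f.toAlgebra
  let : Algebra E G := g.toAlgebra
  let : Algebra F G := (g.comp f).toAlgebra
  have : IsScalarTower F E G := IsScalarTower.of_algebraMap_eq' rfl
  obtain ⟨h1, h2⟩ := hf
  obtain ⟨h3, h4⟩ := hg
  have : FiniteDimensional F G := FiniteDimensional.trans F E G
  refine IsOddFiniteExt.of_algebra F G ?_
  rw [← Module.finrank_mul_finrank F E G]
  exact h2.mul h4

theorem IsOddFiniteExt.id (F : Type*) [Field F] : IsOddFiniteExt F F (RingHom.id F) :=
  IsOddFiniteExt.of_algebra F F (by simp)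

theorem OddZero.mono {ι : Type*} {E : Type u} [Fintype ι] [Field E] {S T : Set (Matrix ι ι E)}
    (h : OddZero S) (hT : T ⊆ S) : OddZero T := by
  obtain ⟨E', _, f, hf, v, hv, h⟩ := h
  exact ⟨E', _, f, hf, v, hv, fun A hA => h A (hT hA)⟩

theorem RatZero.oddZero {ι : Type*} {E : Type u} [Fintype ι] [Field E] {S : Set (Matrix ι ι E)}
    (h : RatZero S) : OddZero S := by
  obtain ⟨v, hv, h⟩ := h
  refine ⟨E, _, RingHom.id E, .id E, v, hv, fun A hA => ?_⟩
  simpa using h A hA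

section
open Polynomial

theorem finrank_quotient_liesOver {L S : Type*} [Field L] [CommRing S] [Algebra L[X] S]
    [Algebra L S] [IsScalarTower L L[X] S] [Module.Finite L[X] S] (P : Ideal S) [P.IsMaximal]
    {p : L[X]} (hp : Irreducible p) [P.LiesOver (Ideal.span {p})] :
    Module.Finite L (S ⧸ P) ∧
      Module.finrank L (S ⧸ P) = p.natDegree * P.inertiaDeg L[X] := by
  have hmax : (Ideal.span {p}).IsMaximal := PrincipalIdealRing.isMaximal_of_irreducible hp
  have : Module.Finite L (L[X] ⧸ Ideal.span {p}) :=
    (AdjoinRoot.powerBasis (f := p) hp.ne_zero).finite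
  have : IsScalarTower L (L[X] ⧸ Ideal.span {p}) (S ⧸ P) := by
    refine IsScalarTower.of_algebraMap_eq (R := L) (S := L[X] ⧸ Ideal.span {p}) (A := S ⧸ P)
      fun x => ?_
    change Ideal.Quotient.mk P (algebraMap L S x) = Ideal.Quotient.mk P (algebraMap L[X] S (C x))
    rw [IsScalarTower.algebraMap_apply L L[X] S]
    rfl
  have : Module.Finite (L[X] ⧸ Ideal.span {p}) (S ⧸ P) :=
    inferInstance
  let := Ideal.Quotient.field (Ideal.span {p})
  refine ⟨Module.Finite.trans (L[X] ⧸ Ideal.span {p}) _, ?_⟩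
  rw [← Module.finrank_mul_finrank L (L[X] ⧸ Ideal.span {p}) (S ⧸ P),
    finrank_quotient_span_eq_natDegree, Ideal.inertiaDeg_eq_of_isMaximal (Ideal.span {p})]

/-- Specialization of a point over a separable extension of `L(X)` to a point over an odd degree
extension of `L`, killing all forms whose value is an integral multiple of `h`. -/
theorem exists_odd_specialization {L E K : Type u} {ι : Type*} [Field L] [Field E] [Field K]
    [Fintype ι] (ψ : L[X] →+* K) (hψ : letI := ψ.toAlgebra; IsFractionRing L[X] K)
    [Algebra K E] [FiniteDimensional K E]
    [Algebra.IsSeparable K E] {p : L[X]} (hp : Irreducible p) (hpodd : Odd p.natDegree)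
    {h : E} {a b : L[X]} {n : ℕ} (hn : Odd n) (ha : ¬ p ∣ a) (hb : b ≠ 0)
    (hh : Algebra.norm K h * ψ b ^ 2 = ψ (p ^ n * a))
    (V : ι → E) (hV : V ≠ 0) :
    ∃ (κ : Type u) (_ : Field κ) (f : L →+* κ), IsOddFiniteExt L κ f ∧
      ∃ u : ι → κ, u ≠ 0 ∧
        (∀ A : Matrix ι ι L,
          qval (A.map ((algebraMap K E).comp (ψ.comp C))) V = 0 →
            qval (A.map f) u = 0) ∧
        ∀ (A B : Matrix ι ι L) (r : L[X]),
          qval (B.map ((algebraMap K E).comp (ψ.comp C))) V = h →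
          qval (A.map ((algebraMap K E).comp (ψ.comp C))) V =
            algebraMap K E (ψ r) * h → qval (A.map f) u = 0 := by
  let : Algebra L[X] K := ψ.toAlgebra
  have : IsFractionRing L[X] K := hψ
  let : Algebra L[X] E := ((algebraMap K E).comp (algebraMap L[X] K)).toAlgebra
  have : IsScalarTower L[X] K E := IsScalarTower.of_algebraMap_eq' rfl
  let S := integralClosure L[X] E
  have : IsFractionRing S E := integralClosure.isFractionRing_of_finite_extension K E
  have : IsDedekindDomain S := integralClosure.isDedekindDomain L[X] K E
  have : Module.Finite L[X] S := IsIntegralClosure.finite L[X] K E S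
  have hinj : Function.Injective (algebraMap L[X] S) := by
    have h1 : Function.Injective (algebraMap L[X] E) :=
      (algebraMap K E).injective.comp (IsFractionRing.injective L[X] K)
    rw [IsScalarTower.algebraMap_eq L[X] S E, RingHom.coe_comp] at h1
    exact Function.Injective.of_comp h1
  have : Module.IsTorsionFree L[X] S := Module.isTorsionFree_iff_algebraMap_injective.2 hinj
  obtain ⟨P, hPmax, hPover, hPdeg, hP⟩ :=
    exists_isMaximal_odd_inertiaDeg (S := S) (K := K) hp.prime hn ha hb hh
  let : Algebra L S := ((algebraMap L[X] S).comp C).toAlgebra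
  have : IsScalarTower L L[X] S := IsScalarTower.of_algebraMap_eq' rfl
  obtain ⟨hfin, hrank⟩ := finrank_quotient_liesOver P hp (L := L)
  let := Ideal.Quotient.field P
  obtain ⟨c, w, hc, hw, i, hi⟩ := exists_scaling_integral_of_isMaximal P V hV
  refine ⟨S ⧸ P, this, algebraMap L (S ⧸ P), IsOddFiniteExt.of_algebra L (S ⧸ P) ?_,
    fun i => Ideal.Quotient.mk P (w i), fun h0 => hi ?_, ?_⟩
  · rw [hrank]; exact hpodd.mul hPdeg
  · rw [← Ideal.Quotient.eq_zero_iff_mem]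
    exact congrFun h0 i
  · have e2 : ∀ A : Matrix ι ι L,
        qval (A.map (algebraMap L (S ⧸ P))) (fun i => Ideal.Quotient.mk P (w i)) =
        Ideal.Quotient.mk P (qval (A.map (algebraMap L S)) w) := by
      intro A
      rw [map_qval, Matrix.map_map]
      rfl
    have e1 : ∀ A : Matrix ι ι L, algebraMap S E (qval (A.map (algebraMap L S)) w) =
        c ^ 2 * qval (A.map ((algebraMap K E).comp (ψ.comp C))) V := by
      intro A
      rw [map_qval, ← qval_smul_vec, Matrix.map_map]
      congr 1
      funext i
      exact hw i
    have hinjS : Function.Injective (algebraMap S E) := IsFractionRing.injective S E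
    refine ⟨fun A hA => ?_, fun A B r hB hA => ?_⟩
    · rw [e2, (map_eq_zero_iff _ hinjS).1 ((e1 A).trans (by rw [hA, mul_zero])), map_zero]
    · have hB' := e1 B
      rw [hB] at hB'
      have hmem : qval (B.map (algebraMap L S)) w ∈ P :=
        hP _ c⁻¹ (by rw [hB']; field_simp)
      have : qval (A.map (algebraMap L S)) w =
          algebraMap L[X] S r * qval (B.map (algebraMap L S)) w := by
        apply hinjS
        rw [map_mul, hB', e1, hA, ← IsScalarTower.algebraMap_apply L[X] S E,
          IsScalarTower.algebraMap_apply L[X] K E]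
        exact mul_left_comm _ _ _
      rw [e2, this, Ideal.Quotient.eq_zero_iff_mem]
      exact P.mul_mem_left _ hmem

end

section
open Polynomial

theorem Polynomial.eval₂_inv_reverse {L K : Type*} [Field L] [Field K] (i : L →+* K) {x : K}
    (hx : x ≠ 0) (p : L[X]) : eval₂ i x⁻¹ p.reverse * x ^ p.natDegree = eval₂ i x p := by
  let := invertibleOfNonzero hx
  rw [← eval₂_reverse_mul_pow i x p, invOf_eq_inv]

section inversion
variable {L K : Type*} [Field L] [Field K] [Algebra L[X] K]

theorem algebraMap_eq_eval₂ (p : L[X]) :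
    eval₂ ((algebraMap L[X] K).comp C) (algebraMap L[X] K X) p = algebraMap L[X] K p := by
  rw [← hom_eval₂, eval₂_C_X]

variable [IsFractionRing L[X] K]

theorem algebraMap_X_ne_zero' : algebraMap L[X] K X ≠ 0 := by
  simp

theorem isFractionRing_eval₂_inv :
    letI := (eval₂RingHom ((algebraMap L[X] K).comp C) (algebraMap L[X] K X)⁻¹).toAlgebra
    IsFractionRing L[X] K := by
  have hX : algebraMap L[X] K X ≠ 0 := algebraMap_X_ne_zero'
  set i := (algebraMap L[X] K).comp C with hi
  set ψ := eval₂RingHom i (algebraMap L[X] K X)⁻¹ with hψ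
  have hrev : ∀ p : L[X], algebraMap L[X] K p =
      ψ p.reverse / ψ X ^ p.natDegree := by
    intro p
    have := eval₂_inv_reverse i hX p
    rw [algebraMap_eq_eval₂] at this
    rw [← this, hψ, coe_eval₂RingHom, eval₂_X, inv_pow, div_inv_eq_mul]
  have hinj : Function.Injective ψ := by
    rw [injective_iff_map_eq_zero]
    intro p hp
    have := eval₂_inv_reverse i (inv_ne_zero hX) p
    rw [inv_inv, algebraMap_eq_eval₂] at this
    rw [hψ, coe_eval₂RingHom] at hp
    rw [hp, mul_eq_zero, map_eq_zero_iff _ (IsFractionRing.injective L[X] K)] at this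
    rcases this with h | h
    · exact reverse_eq_zero.1 h
    · exact absurd h (pow_ne_zero _ (inv_ne_zero hX))
  have hsurj : ∀ z : K, ∃ x y : L[X], z = ψ x / ψ y := by
    intro z
    obtain ⟨a, b, hb, rfl⟩ := IsFractionRing.div_surjective (A := L[X]) z
    refine ⟨a.reverse * X ^ b.natDegree, b.reverse * X ^ a.natDegree, ?_⟩
    have hX' : ψ X ≠ 0 := by rw [Ne, map_eq_zero_iff _ hinj]; exact X_ne_zero
    have hb' : ψ b.reverse ≠ 0 := by
      rw [Ne, map_eq_zero_iff _ hinj, reverse_eq_zero]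
      exact nonZeroDivisors.ne_zero hb
    rw [hrev, hrev, map_mul, map_mul, map_pow, map_pow]
    field_simp
  clear_value ψ
  let alg : Algebra L[X] K := ψ.toAlgebra
  have : FaithfulSMul L[X] K := (faithfulSMul_iff_algebraMap_injective _ _).2 hinj
  exact IsFractionRing.of_field _ _ hsurj

end inversion

open UniqueFactorizationMonoid in
theorem Polynomial.exists_irreducible_odd_natDegree {L : Type*} [Field L] {a : L[X]}
    (ha : Odd a.natDegree) : ∃ (p a' : L[X]) (n : ℕ), Irreducible p ∧ Odd p.natDegree ∧ Odd n ∧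
      ¬ p ∣ a' ∧ a = p ^ n * a' := by
  classical
  have ha0 : a ≠ 0 := by rintro rfl; simp at ha
  have hdeg : a.natDegree = ((normalizedFactors a).map natDegree).sum := by
    rw [← natDegree_multiset_prod]
    · exact (natDegree_eq_of_degree_eq
        (degree_eq_degree_of_associated (prod_normalizedFactors ha0))).symm
    · exact fun h0 => (irreducible_of_normalized_factor _ h0).ne_zero rfl
  rw [hdeg, Finset.sum_multiset_map_count] at ha
  obtain ⟨p, hp, hodd⟩ : ∃ p ∈ (normalizedFactors a).toFinset,
      Odd ((normalizedFactors a).count p • p.natDegree) := by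
    by_contra! h
    exact (Nat.not_even_iff_odd.2 ha)
      (Finset.even_sum _ fun P hP => Nat.not_odd_iff_even.1 (h P hP))
  rw [smul_eq_mul, Nat.odd_mul] at hodd
  rw [Multiset.mem_toFinset] at hp
  have hirr := irreducible_of_normalized_factor p hp
  have hmul := emultiplicity_eq_count_normalizedFactors hirr ha0
  rw [normalize_normalized_factor p hp] at hmul
  have hfin : FiniteMultiplicity p a := finiteMultiplicity_of_emultiplicity_eq_natCast hmul
  obtain ⟨a', h1, h2⟩ := hfin.exists_eq_pow_mul_and_not_dvd
  rw [multiplicity_eq_of_emultiplicity_eq_some hmul] at h1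
  exact ⟨p, a', _, hirr, hodd.2, hodd.1, h2, h1⟩

theorem oddZero_of_separable {L E K : Type u} {ι : Type*} [Field L] [Field E] [Field K]
    [Fintype ι] [Algebra L[X] K] [IsFractionRing L[X] K]
    [Algebra K E] [FiniteDimensional K E] [Algebra.IsSeparable K E]
    (hodd : Odd (Module.finrank K E)) {B0 B1 : Matrix ι ι L} {S : Set (Matrix ι ι L)} {d : ℕ}
    (hd : Odd d) {V : ι → E} (hV : V ≠ 0)
    (hB : qval (B0.map ((algebraMap K E).comp ((algebraMap L[X] K).comp C))) V +
      algebraMap K E (algebraMap L[X] K X) ^ d *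
        qval (B1.map ((algebraMap K E).comp ((algebraMap L[X] K).comp C))) V = 0)
    (hS : ∀ A ∈ S, qval (A.map ((algebraMap K E).comp ((algebraMap L[X] K).comp C))) V = 0) :
    OddZero (insert B0 (insert B1 S)) := by
  have hinj : Function.Injective (algebraMap L[X] K) := IsFractionRing.injective L[X] K
  have hX0 : algebraMap L[X] K X ≠ 0 := algebraMap_X_ne_zero'
  set h := qval (B1.map ((algebraMap K E).comp ((algebraMap L[X] K).comp C))) V with hh
  by_cases h0 : h = 0
  · have hN : Algebra.norm K (algebraMap K E (algebraMap L[X] K X)) * algebraMap L[X] K 1 ^ 2 =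
        algebraMap L[X] K (X ^ (Module.finrank K E) * 1) := by
      rw [Algebra.norm_algebraMap]; simp
    obtain ⟨κ, _, f, hf, u, hu, h1, -⟩ := exists_odd_specialization (algebraMap L[X] K)
      (by convert! ‹IsFractionRing L[X] K›; exact Algebra.algebra_ext _ _ fun _ => rfl)
      irreducible_X (by simp) hodd (fun h => not_isUnit_X (isUnit_of_dvd_one h)) one_ne_zero hN V hV
    refine ⟨κ, _, f, hf, u, hu, ?_⟩
    rintro A (rfl | rfl | hA)
    · exact h1 _ (by rw [h0, mul_zero, add_zero] at hB; exact hB)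
    · exact h1 _ h0
    · exact h1 _ (hS A hA)
  have hN0 : Algebra.norm K h ≠ 0 := Algebra.norm_ne_zero_iff.2 h0
  obtain ⟨a, b, hb, hab⟩ := IsFractionRing.div_surjective (A := L[X]) (Algebra.norm K h)
  have hb0 : b ≠ 0 := nonZeroDivisors.ne_zero hb
  have hb0' : algebraMap L[X] K b ≠ 0 := by simpa [map_eq_zero_iff _ hinj] using hb0
  have hab2 : Algebra.norm K h * algebraMap L[X] K b ^ 2 = algebraMap L[X] K (a * b) := by
    rw [← hab, map_mul]; field_simp
  have hab0 : a * b ≠ 0 := by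
    intro h1
    rw [h1, map_zero, mul_eq_zero] at hab2
    exact hab2.elim hN0 (pow_ne_zero _ hb0')
  generalize a * b = c at hab2 hab0
  clear hab
  rcases Nat.even_or_odd c.natDegree with hc | hc
  · have hB0 : qval (B0.map ((algebraMap K E).comp ((algebraMap L[X] K).comp C))) V =
        -algebraMap K E (algebraMap L[X] K X ^ d) * h := by
      rw [map_pow]; linear_combination hB
    set i := (algebraMap L[X] K).comp C with hi
    set ψ := eval₂RingHom i (algebraMap L[X] K X)⁻¹ with hψ
    have hψC : ψ.comp C = i := by ext; simp [hψ]
    have hrev : ∀ p : L[X], algebraMap L[X] K p * ψ X ^ p.natDegree = ψ p.reverse := by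
      intro p
      have := eval₂_inv_reverse i hX0 p
      rw [algebraMap_eq_eval₂] at this
      rw [← this, hψ, coe_eval₂RingHom, eval₂_X, inv_pow]
      field_simp
    have hψX : ψ X * algebraMap L[X] K X = 1 := by
      rw [hψ, coe_eval₂RingHom, eval₂_X, inv_mul_cancel₀ hX0]
    set e := Module.finrank K E with he
    have hN : Algebra.norm K (-algebraMap K E (algebraMap L[X] K X ^ d) * h) *
        ψ (b.reverse * X ^ (d * e + c.natDegree)) ^ 2 =
        ψ (X ^ (d * e + c.natDegree + 2 * b.natDegree) * -c.reverse) := by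
      have e1 : Algebra.norm K (-algebraMap K E (algebraMap L[X] K X ^ d)) =
          - (algebraMap L[X] K X ^ (d * e)) := by
        rw [← map_neg, Algebra.norm_algebraMap, hodd.neg_pow, pow_mul]
      rw [map_mul, e1]
      simp only [map_mul, map_pow, map_neg]
      rw [← hrev, ← hrev]
      have e2 : algebraMap L[X] K X ^ (d * e) * ψ X ^ (d * e) = 1 := by
        rw [← mul_pow, mul_comm, hψX, one_pow]
      have e3 : Algebra.norm K h = algebraMap L[X] K c / algebraMap L[X] K b ^ 2 := by
        rw [← hab2]; field_simp
      rw [e3]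
      simp only [pow_add, mul_pow, pow_mul' _ 2]
      field_simp
      linear_combination (-algebraMap L[X] K c * ψ X ^ (d * e) * (ψ X ^ c.natDegree) ^ 2 *
        (ψ X ^ b.natDegree) ^ 2) * e2
    obtain ⟨κ, _, f, hf, u, hu, h1, h2⟩ := exists_odd_specialization ψ isFractionRing_eval₂_inv
      irreducible_X (by simp) (n := d * e + c.natDegree + 2 * b.natDegree)
      (((hd.mul hodd).add_even hc).add_even (even_two_mul _)) (by
        rw [X_dvd_iff, coeff_neg, coeff_zero_reverse, neg_eq_zero, leadingCoeff_eq_zero]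
        exact hab0) (by
        simpa [reverse_eq_zero] using hb0) hN V hV
    rw [hψC] at h1 h2
    refine ⟨κ, _, f, hf, u, hu, ?_⟩
    rintro A (rfl | rfl | hA)
    · exact h2 A A 1 hB0 (by rw [hB0]; simp)
    · refine h2 A B0 (-X ^ d) hB0 ?_
      rw [← hh, map_neg, map_neg, neg_mul, neg_mul, mul_neg, neg_neg, ← mul_assoc, ← map_mul,
        map_pow,
        ← mul_pow, hψX,
        one_pow, map_one, one_mul]
    · exact h1 _ (hS A hA)
  · obtain ⟨p, a', n, hp, hpodd, hn, ha', rfl⟩ := Polynomial.exists_irreducible_odd_natDegree hc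
    obtain ⟨κ, _, f, hf, u, hu, h1, h2⟩ := exists_odd_specialization (algebraMap L[X] K)
      (by convert! ‹IsFractionRing L[X] K›; exact Algebra.algebra_ext _ _ fun _ => rfl)
      hp hpodd hn ha' hb0 hab2 V hV
    refine ⟨κ, _, f, hf, u, hu, ?_⟩
    rintro A (rfl | rfl | hA)
    · refine h2 A B1 (-X ^ d) rfl ?_
      rw [map_neg, map_neg, map_pow, map_pow]
      linear_combination hB
    · exact h2 A A 1 rfl (by rw [← hh]; simp)
    · exact h1 _ (hS A hA)

end

section
open Polynomial

theorem odd_of_expChar {L : Type*} [Field L] (h2 : (2 : L) ≠ 0) (q : ℕ) [hq : ExpChar L q] :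
    Odd q := by
  cases hq with
  | zero => exact odd_one
  | prime hp =>
    refine hp.odd_of_ne_two ?_
    rintro rfl
    exact h2 (CharP.cast_eq_zero L 2)

theorem OddZero.of_map_iterateFrobenius {ι : Type*} [Fintype ι] {L : Type u} [Field L]
    (h2 : (2 : L) ≠ 0) (q : ℕ) [ExpChar L q] (n : ℕ) {S : Set (Matrix ι ι L)}
    (h : OddZero ((fun A : Matrix ι ι L => A.map (iterateFrobenius L q n)) '' S)) : OddZero S := by
  obtain ⟨κ, _, f, hf, u, hu, h⟩ := h
  have : ExpChar κ q := expChar_of_injective_ringHom f.injective q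
  have : ExpChar (AlgebraicClosure κ) q :=
    expChar_of_injective_ringHom (algebraMap κ (AlgebraicClosure κ)).injective q
  have hd : 0 < q ^ n := pow_pos (expChar_pos L q) n
  choose w hw using fun i =>
    IsAlgClosed.exists_pow_nat_eq (algebraMap κ (AlgebraicClosure κ) (u i)) hd
  let E := IntermediateField.adjoin κ (Set.range w)
  have hE : FiniteDimensional κ E :=
    IntermediateField.finiteDimensional_adjoin fun x _ => Algebra.IsIntegral.isIntegral x
  have hE' : IsPurelyInseparable κ E := by
    rw [IntermediateField.isPurelyInseparable_adjoin_iff_pow_mem κ _ q]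
    rintro _ ⟨i, rfl⟩
    exact ⟨n, u i, (hw i).symm⟩
  have : ExpChar E q := expChar_of_injective_ringHom (algebraMap κ E).injective q
  obtain ⟨s, hs⟩ := IsPurelyInseparable.finrank_eq_pow κ E q
  have hodd : Odd (Module.finrank κ E) := hs ▸ (odd_of_expChar h2 q).pow
  let w' : ι → E := fun i => ⟨w i, IntermediateField.subset_adjoin _ _ ⟨i, rfl⟩⟩
  have hw' : ∀ i, w' i ^ q ^ n = algebraMap κ E (u i) := fun i => Subtype.ext (hw i)
  refine ⟨E, _, (algebraMap κ E).comp f, (IsOddFiniteExt.of_algebra κ E hodd).comp hf, w',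
    fun h0 => hu ?_, fun A hA => ?_⟩
  · funext i
    apply (algebraMap κ E).injective
    rw [← hw', h0, Pi.zero_apply, Pi.zero_apply, map_zero, zero_pow hd.ne']
  · have h1 := h _ ⟨A, hA, rfl⟩
    apply (iterateFrobenius E q n).injective
    rw [map_zero, ← map_zero (algebraMap κ E), ← h1, map_qval, map_qval, Matrix.map_map,
      Matrix.map_map, Matrix.map_map]
    congr 1
    · congr 1
      funext x
      simp [iterateFrobenius_def]
    · funext i
      simpa [iterateFrobenius_def] using hw' i

/-- If `B0 + X B1` and the constant forms in `S` have a common zero over an odd degree extension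
of `L(X)`, then `B0`, `B1` and the forms in `S` have one over an odd degree extension of `L`. -/
theorem OddZero.of_insert_add_smul {ι : Type*} [Fintype ι] {L K : Type u} [Field L] [Field K]
    [Algebra L[X] K] [IsFractionRing L[X] K] (h2 : (2 : L) ≠ 0) {B0 B1 : Matrix ι ι L}
    {S : Set (Matrix ι ι L)}
    (h : OddZero (insert (B0.map ((algebraMap L[X] K).comp C) +
      algebraMap L[X] K X • B1.map ((algebraMap L[X] K).comp C))
      ((fun A : Matrix ι ι L => A.map ((algebraMap L[X] K).comp C)) '' S))) :
    OddZero (insert B0 (insert B1 S)) := by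
  obtain ⟨K', _, f, hf, v, hv, h⟩ := h
  set i := (algebraMap L[X] K).comp C with hi
  let : Algebra K K' := f.toAlgebra
  obtain ⟨hfin, hodd⟩ := hf
  let E := separableClosure K K'
  obtain ⟨q, _⟩ := ExpChar.exists L
  have : ExpChar K q := expChar_of_injective_ringHom i.injective q
  have : ExpChar K' q := expChar_of_injective_ringHom f.injective q
  have : ExpChar E q := expChar_of_injective_ringHom (algebraMap K E).injective q
  choose m hm using fun j => IsPurelyInseparable.pow_mem E q (v j)
  let n := Finset.univ.sup m
  have hn : ∀ j, v j ^ q ^ n ∈ (algebraMap E K').range := by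
    intro j
    obtain ⟨k, hk⟩ := Nat.exists_eq_add_of_le (Finset.le_sup (f := m) (Finset.mem_univ j))
    change v j ^ q ^ (Finset.univ.sup m) ∈ _
    rw [hk, pow_add, pow_mul]
    exact pow_mem (hm j) _
  choose V hV using hn
  have hoddE : Odd (Module.finrank K E) := by
    rw [← Module.finrank_mul_finrank K E K'] at hodd
    exact Nat.Odd.of_mul_left hodd
  have hpos : q ^ n ≠ 0 := (pow_pos (expChar_pos L q) n).ne'
  have key : ∀ A : Matrix ι ι L, algebraMap E K'
      (qval ((A.map (iterateFrobenius L q n)).map ((algebraMap K E).comp i)) V) =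
      qval (A.map (f.comp i)) v ^ q ^ n := by
    intro A
    rw [← iterateFrobenius_def, map_qval, map_qval]
    congr 1
    · simp only [Matrix.map_map]
      congr 1
      funext x
      simp only [Function.comp, iterateFrobenius_def, map_pow, RingHom.comp_apply]
      rfl
    · funext j
      exact hV j
  apply OddZero.of_map_iterateFrobenius h2 q n
  rw [Set.image_insert_eq, Set.image_insert_eq]
  refine oddZero_of_separable (K := K) (E := E) hoddE (d := q ^ n)
    (odd_of_expChar h2 q).pow (V := V) ?_ ?_ ?_
  · intro h0
    apply hv
    funext j
    have := hV j
    rw [h0, Pi.zero_apply, map_zero] at this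
    exact eq_zero_of_pow_eq_zero this.symm
  · apply (algebraMap E K').injective
    rw [map_add, map_mul, key, key, map_zero]
    have h1 := h _ (Set.mem_insert _ _)
    have e : Matrix.map (B0.map i + algebraMap L[X] K X • B1.map i) f =
        B0.map (f.comp i) + f (algebraMap L[X] K X) • B1.map (f.comp i) := by
      ext; simp [-algebraMap_smul]
    rw [e, qval_add, qval_smul] at h1
    rw [map_pow, ← mul_pow]
    change _ + (f (algebraMap L[X] K X) * _) ^ _ = 0
    rw [← add_pow_expChar_pow, h1, zero_pow hpos]
  · rintro _ ⟨A, hA, rfl⟩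
    apply (algebraMap E K').injective
    rw [key, map_zero]
    have h1 := h _ (Set.mem_insert_of_mem _ ⟨A, hA, rfl⟩)
    rw [Matrix.map_map] at h1
    rw [RingHom.coe_comp, h1, zero_pow hpos]

end

section
open Polynomial

theorem RatZero.map {ι E E' : Type*} [Fintype ι] [Field E] [Field E'] (g : E →+* E')
    {S : Set (Matrix ι ι E)} (h : RatZero S) :
    RatZero ((fun A : Matrix ι ι E => A.map g) '' S) := by
  obtain ⟨v, hv, h⟩ := h
  refine ⟨g ∘ v, fun h0 => hv ?_, ?_⟩
  · funext i
    exact g.injective (by rw [Pi.zero_apply, map_zero]; exact congrFun h0 i)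
  · rintro _ ⟨A, hA, rfl⟩
    rw [← map_qval, h A hA, map_zero]

/-- The `i`-th variable in the rational function field. -/
def fracX (F : Type*) [Field F] {m : ℕ} (i : Fin m) : FractionRing (MvPolynomial (Fin m) F) :=
  algebraMap (MvPolynomial (Fin m) F) _ (MvPolynomial.X i)

theorem exists_hom_fracFinSucc (L : Type u) [Field L] (m : ℕ) :
    ∃ g : FractionRing (MvPolynomial (Fin (m + 1)) L) →+*
        FractionRing (MvPolynomial (Fin m) (FractionRing L[X])),
      g.comp (toFrac L (m + 1)) =
        (toFrac (FractionRing L[X]) m).comp ((algebraMap L[X] (FractionRing L[X])).comp C) ∧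
      g (fracX L 0) = toFrac (FractionRing L[X]) m (algebraMap L[X] (FractionRing L[X]) X) ∧
      ∀ i : Fin m, g (fracX L i.succ) = fracX (FractionRing L[X]) i := by
  let θ : MvPolynomial (Fin (m + 1)) L →+*
      FractionRing (MvPolynomial (Fin m) (FractionRing L[X])) :=
    (algebraMap (MvPolynomial (Fin m) (FractionRing L[X])) _).comp <|
      (MvPolynomial.map (algebraMap L[X] (FractionRing L[X]))).comp <|
      (MvPolynomial.optionEquivRight L (Fin m)).toRingHom.comp <|
      (MvPolynomial.rename (R := L) (_root_.finSuccEquiv m)).toRingHom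
  have hθ : Function.Injective θ := by
    refine (IsFractionRing.injective (MvPolynomial (Fin m) (FractionRing L[X]))
      (FractionRing (MvPolynomial (Fin m) (FractionRing L[X])))).comp ?_
    refine (MvPolynomial.map_injective _ (IsFractionRing.injective L[X] (FractionRing L[X]))).comp
      ?_
    refine (MvPolynomial.optionEquivRight L (Fin m)).injective.comp ?_
    exact MvPolynomial.rename_injective _ (_root_.finSuccEquiv m).injective
  refine ⟨IsFractionRing.lift hθ, ?_, ?_, ?_⟩
  · ext x
    simp [toFrac, θ]
  · simp [toFrac, fracX, θ]
  · intro i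
    simp [fracX, θ]

theorem OddZero.of_ratZero_generic {ι : Type*} [Fintype ι] (m : ℕ) :
    ∀ {L : Type u} [Field L], (2 : L) ≠ 0 → ∀ {B0 : Matrix ι ι L} {B : Fin m → Matrix ι ι L}
      {S : Set (Matrix ι ι L)},
      RatZero (insert (B0.map (toFrac L m) + ∑ i, fracX L i • (B i).map (toFrac L m))
        ((fun A : Matrix ι ι L => A.map (toFrac L m)) '' S)) →
      OddZero (insert B0 (Set.range B ∪ S)) := by
  induction m with
  | zero =>
    intro L _ h2 B0 B S h
    let e : FractionRing (MvPolynomial (Fin 0) L) ≃+* L :=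
      (RingEquiv.ofBijective (toFrac L 0) ⟨(toFrac L 0).injective, fun z => by
        obtain ⟨a, b, hb, rfl⟩ := IsFractionRing.div_surjective (A := MvPolynomial (Fin 0) L) z
        obtain ⟨a, rfl⟩ := MvPolynomial.C_surjective (R := L) (Fin 0) a
        obtain ⟨b, rfl⟩ := MvPolynomial.C_surjective (R := L) (Fin 0) b
        exact ⟨a / b, by simp [toFrac]⟩⟩).symm
    have he : ∀ A : Matrix ι ι L, (A.map (toFrac L 0)).map e = A := by
      intro A
      ext i j
      exact e.apply_symm_apply _
    refine (h.map e.toRingHom).oddZero.mono ?_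
    rintro A (rfl | ⟨i, -⟩ | hA)
    · exact ⟨_, Set.mem_insert _ _, by simpa using he A⟩
    · exact i.elim0
    · exact ⟨_, Set.mem_insert_of_mem _ ⟨A, hA, rfl⟩, he A⟩
  | succ m ih =>
    intro L _ h2 B0 B S h
    obtain ⟨g, h1, h3, h4⟩ := exists_hom_fracFinSucc L m
    set i := (algebraMap L[X] (FractionRing L[X])).comp C with hi
    have h2' : (2 : FractionRing L[X]) ≠ 0 := by
      rw [← map_ofNat i 2]
      exact (map_ne_zero i).2 h2
    have hg : ∀ A : Matrix ι ι L, (A.map (toFrac L (m + 1))).map g =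
        (A.map i).map (toFrac (FractionRing L[X]) m) := by
      intro A
      rw [Matrix.map_map, Matrix.map_map, ← RingHom.coe_comp, ← RingHom.coe_comp, h1]
    have key := ih h2' (B0 := B0.map i + algebraMap L[X] (FractionRing L[X]) X • (B 0).map i)
      (B := fun j => (B j.succ).map i) (S := (fun A : Matrix ι ι L => A.map i) '' S) (by
        refine (congrArg RatZero ?_).mpr (h.map g)
        rw [Set.image_insert_eq, Set.image_image, Set.image_image]
        congr 1
        · rw [Fin.sum_univ_succ]
          ext a b
          have hg' : ∀ x, g (toFrac L (m + 1) x) = toFrac (FractionRing L[X]) m (i x) :=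
            fun x => congrArg (fun φ : L →+* _ => φ x) h1
          simp [Matrix.sum_apply, h3, h4, hg', -algebraMap_smul, add_assoc]
        · exact Set.image_congr fun A _ => (hg A).symm)
    have := (key.mono (T := insert (B0.map i + algebraMap L[X] (FractionRing L[X]) X • (B 0).map i)
      ((fun A : Matrix ι ι L => A.map i) '' (Set.range (fun j : Fin m => B j.succ) ∪ S))) (by
        rw [Set.image_union, ← Set.range_comp]
        rfl)).of_insert_add_smul h2
    refine this.mono ?_
    rintro A (rfl | ⟨j, rfl⟩ | hA)
    · simp
    · cases j using Fin.cases <;> simp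
    · simp [hA]

end

section
open Polynomial

/-- The quadratic form with matrix `A` has a nontrivial zero. -/
def HasZero {ι E : Type*} [Fintype ι] [CommRing E] (A : Matrix ι ι E) : Prop :=
  ∃ v : ι → E, v ≠ 0 ∧ qval A v = 0

theorem natDegree_qval_map_C {K ι : Type*} [Field K] [Fintype ι] {A : Matrix ι ι K}
    (hA : ¬ HasZero A) {p : ι → K[X]} {d : ℕ} (hd : ∀ i, (p i).natDegree ≤ d)
    {i : ι} (hi : p i ≠ 0) (hid : (p i).natDegree = d) :
    (qval (A.map C) p).natDegree = 2 * d := by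
  have hle : ∀ a b, (p a * (C (A a b) * p b)).natDegree ≤ d + d := fun a b =>
    natDegree_mul_le_of_le (hd a) ((natDegree_C_mul_le _ _).trans (hd b))
  have hq : qval (A.map C) p = ∑ a, ∑ b, p a * (C (A a b) * p b) := by
    simp [qval, dotProduct, Matrix.mulVec, Finset.mul_sum]
  rw [two_mul]
  apply natDegree_eq_of_le_of_coeff_ne_zero
  · rw [hq]
    exact natDegree_sum_le_of_forall_le _ _ fun a _ =>
      natDegree_sum_le_of_forall_le _ _ fun b _ => hle a b
  · intro h0
    refine hA ⟨fun a => (p a).coeff d, fun h => hi ?_, ?_⟩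
    · rw [← leadingCoeff_eq_zero, leadingCoeff, hid]
      exact congrFun h i
    · rw [← h0, hq]
      simp only [finsetSum_coeff, qval, dotProduct, Matrix.mulVec, Finset.mul_sum]
      refine Finset.sum_congr rfl fun a _ => Finset.sum_congr rfl fun b _ => ?_
      rw [coeff_mul_add_eq_of_natDegree_le (hd a) ((natDegree_C_mul_le _ _).trans (hd b)),
        coeff_C_mul]

theorem hasZero_of_dvd_qval {K ι : Type*} [Field K] [Fintype ι] (A : Matrix ι ι K) (n : ℕ) :
    ∀ f : K[X], Irreducible f → f.natDegree = n → Odd n → ∀ p : ι → K[X],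
      f ∣ qval (A.map C) p → (∃ i, ¬ f ∣ p i) → HasZero A := by
  classical
  induction n using Nat.strong_induction_on with
  | _ n ih =>
  intro f hf hfn hn p hp ⟨i, hi⟩
  by_contra hA
  let r : ι → K[X] := fun j => p j % f
  have hr : f ∣ qval (A.map C) r := by
    rw [← AdjoinRoot.mk_eq_zero, map_qval] at hp ⊢
    convert hp using 2
    funext j
    change AdjoinRoot.mk f (p j % f) = AdjoinRoot.mk f (p j)
    rw [EuclideanDomain.mod_eq_sub_mul_div, map_sub, map_mul, AdjoinRoot.mk_self, zero_mul,
      sub_zero]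
  have hri : r i ≠ 0 := fun h => hi (EuclideanDomain.mod_eq_zero.1 h)
  let := UniqueFactorizationMonoid.toNormalizedGCDMonoid K[X]
  obtain ⟨s, hs, hgcd⟩ := Finset.extract_gcd r (s := Finset.univ) ⟨i, Finset.mem_univ i⟩
  set g := Finset.univ.gcd r
  have hs : ∀ j, r j = g * s j := fun j => hs j (Finset.mem_univ j)
  have hg0 : g ≠ 0 := fun h => hri (by rw [hs, h, zero_mul])
  have hsi : s i ≠ 0 := fun h => hri (by rw [hs, h, mul_zero])
  have hrn : ∀ j, (r j).natDegree < n := fun j => by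
    rw [← hfn]
    refine natDegree_mod_lt _ fun h0 => ?_
    rw [← hfn, h0] at hn
    simp at hn
  have hsn : ∀ j, (s j).natDegree < n := fun j => by
    by_cases h : s j = 0
    · rw [h, natDegree_zero]; exact hn.pos
    · have := hrn j
      rw [hs, natDegree_mul hg0 h] at this
      omega
  have hgn : g.natDegree < n := by
    have := hrn i
    rw [hs, natDegree_mul hg0 hsi] at this
    omega
  have hfg : ¬ f ∣ g := fun h => by
    have := natDegree_le_of_dvd h hg0
    omega
  have hfs : f ∣ qval (A.map C) s := by
    have hrs : r = g • s := funext hs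
    rw [hrs, qval_smul_vec] at hr
    exact (hf.prime.dvd_or_dvd hr).resolve_left fun h => hfg (hf.prime.dvd_of_dvd_pow h)
  obtain ⟨l, hl, hlmax⟩ := Finset.exists_max_image (Finset.univ.filter fun j => s j ≠ 0)
    (fun j => (s j).natDegree) ⟨i, by simpa using hsi⟩
  have hdeg := natDegree_qval_map_C hA (p := s) (d := (s l).natDegree) (fun j => by
    by_cases h : s j = 0
    · simp [h]
    · exact hlmax j (by simpa using h)) (by simpa using hl) rfl
  obtain ⟨h, hh⟩ := hfs
  have hh0 : h ≠ 0 := by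
    rintro rfl
    rw [mul_zero] at hh
    rw [hh, natDegree_zero] at hdeg
    have hd0 : (s l).natDegree = 0 := by omega
    have hconst : ∀ j, s j = C ((s j).coeff 0) := fun j => eq_C_of_natDegree_eq_zero (by
      by_cases h : s j = 0
      · simp [h]
      · have := hlmax j (by simpa using h)
        omega)
    refine hA ⟨fun j => (s j).coeff 0, fun h => hsi ?_, ?_⟩
    · rw [hconst i, congrFun h i]; simp
    · apply C_injective
      rw [map_qval, map_zero, ← hh]
      congr 1
      funext j
      exact (hconst j).symm
  rw [hh, natDegree_mul hf.ne_zero hh0, hfn] at hdeg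
  have hln := hsn l
  obtain ⟨f', a', k, hf', hfodd, hk, -, hha⟩ :=
    Polynomial.exists_irreducible_odd_natDegree (a := h) (by
      obtain ⟨t, ht⟩ := hn
      exact ⟨(s l).natDegree - t - 1, by omega⟩)
  have hdvd : f' ∣ h := hha ▸ Dvd.dvd.mul_right (dvd_pow_self _ hk.pos.ne') _
  have hlt := natDegree_le_of_dvd hdvd hh0
  refine hA (ih f'.natDegree (by omega) f' hf' rfl hfodd s (hh ▸ hdvd.mul_left f) ?_)
  by_contra! hall
  exact hf'.not_isUnit (isUnit_of_dvd_one (hgcd ▸ Finset.dvd_gcd fun j _ => hall j))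

theorem HasZero.of_adjoin_simple {K E ι : Type*} [Field K] [Field E] [Algebra K E] [Fintype ι]
    {A : Matrix ι ι K} {α : E} (hα : IsIntegral K α)
    (hodd : Odd (Module.finrank K (IntermediateField.adjoin K {α})))
    (h : HasZero (A.map (algebraMap K (IntermediateField.adjoin K {α})))) : HasZero A := by
  obtain ⟨v, hv, h⟩ := h
  have hlift : ∀ i, ∃ p : K[X], aeval (IntermediateField.AdjoinSimple.gen K α) p = v i := by
    intro i
    have : v i ∈ (⊤ : Subalgebra K (IntermediateField.adjoin K {α})) := trivial
    rw [← (IntermediateField.adjoin.powerBasis hα).adjoin_gen_eq_top,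
      Algebra.adjoin_singleton_eq_range_aeval] at this
    exact this
  choose p hp using hlift
  have hdvd : ∀ r : K[X], minpoly K α ∣ r ↔
      aeval (IntermediateField.AdjoinSimple.gen K α) r = 0 := by
    intro r
    rw [← IntermediateField.minpoly_gen K α, minpoly.dvd_iff]
  refine hasZero_of_dvd_qval A _ (minpoly K α) (minpoly.irreducible hα) rfl ?_ p ?_ ?_
  · rwa [IntermediateField.adjoin.finrank hα] at hodd
  · rw [hdvd, ← h, ← AlgHom.coe_toRingHom, map_qval, Matrix.map_map]
    congr 1
    · congr 1
      funext x
      simp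
    · exact funext hp
  · by_contra! hall
    exact hv (funext fun i => by rw [← hp, (hdvd _).1 (hall i)]; rfl)

theorem HasZero.of_odd_finrank {ι : Type*} [Fintype ι] (n : ℕ) :
    ∀ {K E : Type u} [Field K] [Field E] [Algebra K E] [FiniteDimensional K E],
      Module.finrank K E = n → Odd n → ∀ {A : Matrix ι ι K},
      HasZero (A.map (algebraMap K E)) → HasZero A := by
  induction n using Nat.strong_induction_on with
  | _ n ih =>
  intro K E _ _ _ _ hn hodd A h
  by_cases hsurj : Function.Surjective (algebraMap K E)
  · obtain ⟨v, hv, h⟩ := h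
    choose w hw using fun i => hsurj (v i)
    refine ⟨w, fun h0 => hv (funext fun i => by rw [← hw, h0]; simp), ?_⟩
    apply (algebraMap K E).injective
    rw [map_qval, map_zero, ← h]
    congr 1
    exact funext hw
  · simp only [Function.Surjective, not_forall] at hsurj
    obtain ⟨α, hα⟩ := hsurj
    let F := IntermediateField.adjoin K {α}
    have hmul := Module.finrank_mul_finrank K F E
    rw [hn] at hmul
    have hoddmul := hodd
    rw [← hmul, Nat.odd_mul] at hoddmul
    have h1 : Module.finrank K F ≠ 1 := by
      rw [Ne, IntermediateField.finrank_eq_one_iff, IntermediateField.adjoin_simple_eq_bot_iff]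
      exact hα
    have hpos : 0 < Module.finrank F E := Module.finrank_pos
    have hlt : Module.finrank F E < n := by
      have := hoddmul.1.pos
      nlinarith [show 2 ≤ Module.finrank K F by omega]
    refine HasZero.of_adjoin_simple (Algebra.IsIntegral.isIntegral α) hoddmul.1
      (ih _ hlt (K := F) (E := E) rfl hoddmul.2 ?_)
    rw [Matrix.map_map]
    exact h

/-- **Springer's theorem**. -/
theorem OddZero.hasZero {ι : Type*} [Fintype ι] {K : Type u} [Field K] {A : Matrix ι ι K}
    (h : OddZero {A}) : HasZero A := by
  obtain ⟨E, _, f, ⟨hfin, hodd⟩, v, hv, h⟩ := h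
  let : Algebra K E := f.toAlgebra
  exact HasZero.of_odd_finrank _ (K := K) (E := E) rfl hodd ⟨v, hv, h A rfl⟩

end

section rationalFunctions
variable {F : Type*} [Field F] {m : ℕ}

theorem subfield_eq_top_of_toFrac_mem {K : Subfield (FractionRing (MvPolynomial (Fin m) F))}
    (hC : ∀ x, toFrac F m x ∈ K) (hX : ∀ i, fracX F i ∈ K) : K = ⊤ := by
  have hp : ∀ p : MvPolynomial (Fin m) F, algebraMap _ (FractionRing (MvPolynomial (Fin m) F)) p ∈
      K := by
    intro p
    induction p using MvPolynomial.induction_on with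
    | C a => exact hC a
    | add p q hp hq => rw [map_add]; exact add_mem hp hq
    | mul_X p i hp => rw [map_mul]; exact mul_mem hp (hX i)
  refine eq_top_iff.2 fun z _ => ?_
  obtain ⟨a, b, -, rfl⟩ := IsFractionRing.div_surjective (A := MvPolynomial (Fin m) F) z
  exact div_mem (hp a) (hp b)

theorem fracHom_ext {K : Type*} [Field K] {f g : FractionRing (MvPolynomial (Fin m) F) →+* K}
    (hC : f.comp (toFrac F m) = g.comp (toFrac F m)) (hX : ∀ i, f (fracX F i) = g (fracX F i)) :
    f = g := by
  have h : f.eqLocusField g = ⊤ := subfield_eq_top_of_toFrac_mem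
    (fun x => congrArg (fun φ : F →+* K => φ x) hC) hX
  exact RingHom.ext fun x => (h ▸ Subfield.mem_top x : x ∈ f.eqLocusField g)

/-- The embedding `F(x_1, …, x_m) → E(x_1, …, x_m)` induced by `f : F → E`. -/
def rmap {E : Type*} [Field E] (f : F →+* E) (m : ℕ) :
    FractionRing (MvPolynomial (Fin m) F) →+* FractionRing (MvPolynomial (Fin m) E) :=
  letI := f.toAlgebra
  transMap F E m

variable {E : Type*} [Field E]

theorem rmap_comp_toFrac (f : F →+* E) (m : ℕ) :
    (rmap f m).comp (toFrac F m) = (toFrac E m).comp f := by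
  ext x
  simp [rmap, transMap, toFrac]
  rfl

theorem rmap_toFrac (f : F →+* E) (x : F) : rmap f m (toFrac F m x) = toFrac E m (f x) :=
  congrArg (fun φ : F →+* _ => φ x) (rmap_comp_toFrac f m)

theorem rmap_fracX (f : F →+* E) (i : Fin m) : rmap f m (fracX F i) = fracX E i := by
  simp [rmap, transMap, fracX]

theorem exists_bijective_fracAdd (F : Type*) [Field F] (l m : ℕ) :
    ∃ ψ : FractionRing (MvPolynomial (Fin (l + m)) F) →+*
        FractionRing (MvPolynomial (Fin m) (FractionRing (MvPolynomial (Fin l) F))),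
      Function.Bijective ψ ∧ (∀ x, ψ (toFrac F _ x) = toFrac _ m (toFrac F l x)) ∧
      (∀ i, ψ (fracX F (Fin.castAdd m i)) = toFrac _ m (fracX F i)) ∧
      ∀ i, ψ (fracX F (Fin.natAdd l i)) = fracX _ i := by
  let e : Fin (l + m) ≃ Fin m ⊕ Fin l := finSumFinEquiv.symm.trans (Equiv.sumComm _ _)
  let θ : MvPolynomial (Fin (l + m)) F →+*
      FractionRing (MvPolynomial (Fin m) (FractionRing (MvPolynomial (Fin l) F))) :=
    (algebraMap (MvPolynomial (Fin m) (FractionRing (MvPolynomial (Fin l) F))) _).comp <|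
      (MvPolynomial.map (algebraMap (MvPolynomial (Fin l) F) (FractionRing _))).comp <|
      (MvPolynomial.sumAlgEquiv F (Fin m) (Fin l)).toRingHom.comp <|
      (MvPolynomial.rename (R := F) e).toRingHom
  have hθ : Function.Injective θ := by
    refine (IsFractionRing.injective (MvPolynomial (Fin m) (FractionRing (MvPolynomial (Fin l) F)))
      (FractionRing (MvPolynomial (Fin m) (FractionRing (MvPolynomial (Fin l) F))))).comp ?_
    refine (MvPolynomial.map_injective _ (IsFractionRing.injective (MvPolynomial (Fin l) F)
      (FractionRing (MvPolynomial (Fin l) F)))).comp ?_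
    refine (MvPolynomial.sumAlgEquiv F (Fin m) (Fin l)).injective.comp ?_
    exact MvPolynomial.rename_injective _ e.injective
  let ψ := IsFractionRing.lift (K := FractionRing (MvPolynomial (Fin (l + m)) F)) hθ
  have h1 : ∀ x, ψ (toFrac F _ x) = toFrac _ m (toFrac F l x) := by
    intro x
    simp [ψ, toFrac, θ]
  have h2 : ∀ i, ψ (fracX F (Fin.castAdd m i)) = toFrac _ m (fracX F i) := by
    intro i
    simp [ψ, toFrac, fracX, θ, e]
  have h3 : ∀ i, ψ (fracX F (Fin.natAdd l i)) = fracX _ i := by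
    intro i
    simp [ψ, fracX, θ, e]
  refine ⟨ψ, ⟨ψ.injective, ?_⟩, h1, h2, h3⟩
  rw [← RingHom.fieldRange_eq_top_iff]
  refine subfield_eq_top_of_toFrac_mem (fun x => ?_) fun i => ⟨_, h3 i⟩
  have : ψ.fieldRange.comap (toFrac _ m) = ⊤ :=
    subfield_eq_top_of_toFrac_mem (fun x => ⟨_, h1 x⟩) fun i => ⟨_, h2 i⟩
  exact (this ▸ Subfield.mem_top x : x ∈ ψ.fieldRange.comap (toFrac _ m))

theorem exists_natural_bijective_fracAdd {F E : Type*} [Field F] [Field E] (f : F →+* E)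
    (l m : ℕ) {ψ : FractionRing (MvPolynomial (Fin (l + m)) F) →+*
        FractionRing (MvPolynomial (Fin m) (FractionRing (MvPolynomial (Fin l) F)))}
    (h1 : ∀ x, ψ (toFrac F _ x) = toFrac _ m (toFrac F l x))
    (h2 : ∀ i, ψ (fracX F (Fin.castAdd m i)) = toFrac _ m (fracX F i))
    (h3 : ∀ i, ψ (fracX F (Fin.natAdd l i)) = fracX _ i) :
    ∃ ψ' : FractionRing (MvPolynomial (Fin (l + m)) E) →+*
        FractionRing (MvPolynomial (Fin m) (FractionRing (MvPolynomial (Fin l) E))),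
      Function.Bijective ψ' ∧ ∀ x, rmap (rmap f l) m (ψ x) = ψ' (rmap f (l + m) x) := by
  obtain ⟨ψ', hb, h1', h2', h3'⟩ := exists_bijective_fracAdd E l m
  refine ⟨ψ', hb, fun x => ?_⟩
  have : (rmap (rmap f l) m).comp ψ = ψ'.comp (rmap f (l + m)) := by
    refine fracHom_ext ?_ ?_
    · ext x
      simp [rmap_toFrac, h1, h1']
    · intro i
      cases i using Fin.addCases <;> simp [rmap_toFrac, rmap_fracX, h2, h2', h3, h3']
  exact congrArg (fun φ : _ →+* FractionRing (MvPolynomial (Fin m)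
    (FractionRing (MvPolynomial (Fin l) E))) => φ x) this

end rationalFunctions

theorem HasZero.map {ι E E' : Type*} [Fintype ι] [Field E] [Field E'] {A : Matrix ι ι E}
    (h : HasZero A) (g : E →+* E') : HasZero (A.map g) := by
  obtain ⟨v, hv, h⟩ := h
  refine ⟨g ∘ v, fun h0 => hv ?_, by rw [← map_qval, h, map_zero]⟩
  funext i
  exact g.injective (by rw [Pi.zero_apply, map_zero]; exact congrFun h0 i)

theorem hasZero_map_iff {ι E E' : Type*} [Fintype ι] [Field E] [Field E'] {A : Matrix ι ι E}
    {g : E →+* E'} (hg : Function.Bijective g) : HasZero (A.map g) ↔ HasZero A := by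
  refine ⟨fun h => ?_, fun h => h.map g⟩
  let e := RingEquiv.ofBijective g hg
  convert h.map e.symm.toRingHom
  ext i j
  exact (e.symm_apply_apply (A i j)).symm

theorem HasZero.of_toFrac {ι : Type*} [Fintype ι] {E : Type u} [Field E] (h2 : (2 : E) ≠ 0)
    {A : Matrix ι ι E} {m : ℕ} (h : HasZero (A.map (toFrac E m))) : HasZero A := by
  obtain ⟨v, hv, h⟩ := h
  refine ((OddZero.of_ratZero_generic m h2 (B0 := A) (B := 0) (S := ∅)
    ⟨v, hv, ?_⟩).mono ?_).hasZero
  · simpa [Matrix.map_zero] using h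
  · simp

theorem hasZero_toFrac_iff {ι : Type*} [Fintype ι] {E : Type u} [Field E] (h2 : (2 : E) ≠ 0)
    {A : Matrix ι ι E} {m : ℕ} : HasZero (A.map (toFrac E m)) ↔ HasZero A :=
  ⟨HasZero.of_toFrac h2, fun h => h.map _⟩

/-- The matrix of the Pfister form `⟨⟨a_1, …, a_n⟩⟩`, with subsets encoded by their
characteristic functions. -/
def pfMatrix {F : Type*} [Field F] {n : ℕ} (a : Fin n → F) :
    Matrix (Fin n → Bool) (Fin n → Bool) F :=
  Matrix.diagonal fun b => ∏ i, if b i then -a i else 1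

theorem pfMatrix_map {F E : Type*} [Field F] [Field E] {n : ℕ} (a : Fin n → F) (f : F →+* E) :
    (pfMatrix a).map f = pfMatrix (f ∘ a) := by
  rw [pfMatrix, Matrix.diagonal_map (map_zero f), pfMatrix]
  congr 1
  funext b
  simp [map_prod, apply_ite f]

/-- A property of extensions of `F` which is equivalent to isotropy of a Pfister form
over rational function fields. -/
def PfisterEncodable (F : Type u) [Field F]
    (P : ∀ (E : Type u) [Field E], (F →+* E) → Prop) : Prop :=
  ∃ (m n : ℕ) (a : Fin n → FractionRing (MvPolynomial (Fin m) F)), (∀ i, a i ≠ 0) ∧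
    ∀ (E : Type u) [Field E] (f : F →+* E), HasZero (pfMatrix (rmap f m ∘ a)) ↔ P E f

theorem PfisterEncodable.of_rmap {F : Type u} [Field F] {l : ℕ}
    {P : ∀ (E : Type u) [Field E], (F →+* E) → Prop}
    {P' : ∀ (E : Type u) [Field E], (FractionRing (MvPolynomial (Fin l) F) →+* E) → Prop}
    (h : PfisterEncodable (FractionRing (MvPolynomial (Fin l) F)) P')
    (hP : ∀ (E : Type u) [Field E] (f : F →+* E),
      P' (FractionRing (MvPolynomial (Fin l) E)) (rmap f l) ↔ P E f) : PfisterEncodable F P := by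
  obtain ⟨m, n, a, ha, h⟩ := h
  obtain ⟨ψ, hψ, h1, h2, h3⟩ := exists_bijective_fracAdd F l m
  choose b hb using fun i => hψ.2 (a i)
  refine ⟨l + m, n, b, fun i h0 => ha i ?_, fun E _ f => ?_⟩
  · rw [← hb, h0, map_zero]
  · obtain ⟨ψ', hψ', hnat⟩ := exists_natural_bijective_fracAdd f l m h1 h2 h3
    rw [← hP, ← h, ← hasZero_map_iff hψ', pfMatrix_map]
    have : rmap (rmap f l) m ∘ a = ψ' ∘ rmap f (l + m) ∘ b := by
      funext i
      simp only [Function.comp, ← hnat, hb]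
    rw [this]

theorem PfisterEncodable.congr {F : Type u} [Field F]
    {P P' : ∀ (E : Type u) [Field E], (F →+* E) → Prop} (h : PfisterEncodable F P')
    (hP : ∀ (E : Type u) [Field E] (f : F →+* E), P' E f ↔ P E f) : PfisterEncodable F P := by
  obtain ⟨m, n, a, ha, h⟩ := h
  exact ⟨m, n, a, ha, fun E _ f => (h E f).trans (hP E f)⟩

section orthogonalSum
variable {ι κ F : Type*} [Field F]

/-- The orthogonal sum of two forms. -/
def dsum (A : Matrix ι ι F) (B : Matrix κ κ F) : Matrix (ι ⊕ κ) (ι ⊕ κ) F :=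
  Matrix.fromBlocks A 0 0 B

theorem dsum_map {E : Type*} [Field E] (A : Matrix ι ι F) (B : Matrix κ κ F) (f : F →+* E) :
    (dsum A B).map f = dsum (A.map f) (B.map f) := by
  simp [dsum, Matrix.fromBlocks_map, Matrix.map_zero]

variable [Fintype ι] [Fintype κ]

theorem qval_dsum (A : Matrix ι ι F) (B : Matrix κ κ F) (v : ι ⊕ κ → F) :
    qval (dsum A B) v = qval A (v ∘ Sum.inl) + qval B (v ∘ Sum.inr) := by
  simp [qval, dsum, dotProduct, Matrix.mulVec, Fintype.sum_sum_type]

theorem HasZero.dsum_left {A : Matrix ι ι F} (h : HasZero A) (B : Matrix κ κ F) :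
    HasZero (dsum A B) := by
  obtain ⟨v, hv, h⟩ := h
  refine ⟨Sum.elim v 0, fun h0 => hv ?_, ?_⟩
  · funext i
    exact congrFun h0 (Sum.inl i)
  · simp [qval_dsum, h, qval_zero_vec]

theorem qval_transpose_mul_mul (P : Matrix κ ι F) (B : Matrix κ κ F) (v : ι → F) :
    qval (P.transpose * B * P) v = qval B (P.mulVec v) := by
  simp only [qval, ← Matrix.mulVec_mulVec, Matrix.dotProduct_mulVec, Matrix.vecMul_transpose]

end orthogonalSum

section similitudes
variable {ι κ F : Type*} [Fintype ι] [Fintype κ] [Field F]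

/-- `l` is a similarity factor of `A`, via a similitude having an adjoint similitude. -/
def Sim (A : Matrix ι ι F) (l : F) : Prop :=
  ∃ N N' : Matrix ι ι F, N.transpose * A * N = l • A ∧ N'.transpose * A * N' = l • A ∧
    A * N = N'.transpose * A ∧ N.transpose * A = A * N'

theorem Sim.mul {A : Matrix ι ι F} {l l' : F} (h : Sim A l) (h' : Sim A l') : Sim A (l * l') := by
  obtain ⟨N, N', h1, h2, h3, h4⟩ := h
  obtain ⟨M, M', h1', h2', h3', h4'⟩ := h'
  have e1 : ∀ {N M : Matrix ι ι F} {l l' : F}, N.transpose * A * N = l • A →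
      M.transpose * A * M = l' • A → (N * M).transpose * A * (N * M) = (l * l') • A := by
    intro N M l l' h h'
    have : (N * M).transpose * A * (N * M) = M.transpose * (N.transpose * A * N) * M := by
      simp only [Matrix.transpose_mul, Matrix.mul_assoc]
    rw [this, h, Matrix.mul_smul, Matrix.smul_mul, h', smul_smul]
  refine ⟨N * M, M' * N', e1 h1 h1', (mul_comm l l') ▸ e1 h2' h2, ?_, ?_⟩
  · rw [← Matrix.mul_assoc, h3, Matrix.mul_assoc, h3', Matrix.transpose_mul, Matrix.mul_assoc]
  · rw [Matrix.transpose_mul, Matrix.mul_assoc, h4, ← Matrix.mul_assoc, h4', Matrix.mul_assoc]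

theorem Sim.submatrix {A : Matrix κ κ F} {l : F} (h : Sim A l) (e : ι ≃ κ) :
    Sim (A.submatrix e e) l := by
  obtain ⟨N, N', h1, h2, h3, h4⟩ := h
  refine ⟨N.submatrix e e, N'.submatrix e e, ?_⟩
  simp only [Matrix.transpose_submatrix, Matrix.submatrix_mul_equiv, h1, h2, h3, h4.symm,
    Matrix.submatrix_smul, Pi.smul_apply, and_self]

/-- The form represents only similarity factors. -/
def IsRound (A : Matrix ι ι F) : Prop := ∀ u, Sim A (qval A u)

theorem IsRound.exists_qval_mul {A : Matrix ι ι F} (h : IsRound A) (u v : ι → F) :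
    ∃ w, qval A w = qval A u * qval A v := by
  obtain ⟨N, -, h1, -⟩ := h u
  exact ⟨N.mulVec v, by rw [← qval_transpose_mul_mul, h1, qval_smul]⟩

theorem IsRound.submatrix {A : Matrix κ κ F} (h : IsRound A) (e : ι ≃ κ) :
    IsRound (A.submatrix e e) := by
  intro u
  have : qval (A.submatrix e e) u = qval A (u ∘ e.symm) := by
    simp only [qval, dotProduct, Matrix.mulVec]
    rw [← e.sum_comp]
    refine Finset.sum_congr rfl fun i _ => ?_
    rw [← e.sum_comp]
    simp
  rw [this]
  exact (h _).submatrix e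

theorem IsRound.hasZero_dsum_smul {A : Matrix ι ι F} (h : IsRound A) {d : F}
    (hd : HasZero (dsum A (-d • A))) :
    HasZero A ∨ HasZero (dsum (Matrix.diagonal fun _ : Unit => -d) A) := by
  by_cases hA : HasZero A
  · exact Or.inl hA
  right
  obtain ⟨u, hu, h0⟩ := hd
  rw [qval_dsum, qval_smul] at h0
  have hr : qval A (u ∘ Sum.inr) ≠ 0 := by
    intro hr
    have hr0 : u ∘ Sum.inr = 0 := by
      by_contra h1
      exact hA ⟨_, h1, hr⟩
    have hl0 : u ∘ Sum.inl = 0 := by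
      by_contra h1
      exact hA ⟨_, h1, by rw [hr, mul_zero, add_zero] at h0; exact h0⟩
    apply hu
    funext i
    rcases i with i | i
    · exact congrFun hl0 i
    · exact congrFun hr0 i
  obtain ⟨w, hw⟩ := h.exists_qval_mul (u ∘ Sum.inl) (u ∘ Sum.inr)
  refine ⟨Sum.elim (fun _ => 1) ((qval A (u ∘ Sum.inr))⁻¹ • w), fun h1 => ?_, ?_⟩
  · exact one_ne_zero (congrFun h1 (Sum.inl ()))
  · rw [qval_dsum, Sum.elim_comp_inr, qval_smul_vec, hw, Sum.elim_comp_inl]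
    have : qval (Matrix.diagonal fun _ : Unit => -d) (fun _ => 1) = -d := by simp [qval]
    rw [this]
    field_simp
    linear_combination h0

end similitudes

section forms
variable {ι κ ι' κ' τ F : Type*} [Fintype ι] [Fintype κ] [Fintype ι'] [Fintype κ'] [Fintype τ]
  [DecidableEq ι] [DecidableEq κ] [DecidableEq ι'] [DecidableEq κ'] [DecidableEq τ] [Field F]

/-- Congruence of matrices over possibly different index types. -/
def Cong (A : Matrix ι ι F) (B : Matrix κ κ F) : Prop :=
  ∃ (P : Matrix κ ι F) (P' : Matrix ι κ F), P * P' = 1 ∧ P' * P = 1 ∧ A = P.transpose * B * P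

theorem Cong.refl (A : Matrix ι ι F) : Cong A A := ⟨1, 1, by simp, by simp, by simp⟩

theorem Cong.symm {A : Matrix ι ι F} {B : Matrix κ κ F} (h : Cong A B) : Cong B A := by
  obtain ⟨P, P', h1, h2, rfl⟩ := h
  refine ⟨P', P, h2, h1, ?_⟩
  have h3 : P'.transpose * P.transpose = 1 := by rw [← Matrix.transpose_mul, h1]; simp
  rw [Matrix.mul_assoc, Matrix.mul_assoc, h1, Matrix.mul_one, ← Matrix.mul_assoc, h3,
    Matrix.one_mul]

theorem Cong.trans {A : Matrix ι ι F} {B : Matrix κ κ F} {D : Matrix τ τ F} (h : Cong A B)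
    (h' : Cong B D) : Cong A D := by
  obtain ⟨P, P', h1, h2, rfl⟩ := h
  obtain ⟨Q, Q', h3, h4, rfl⟩ := h'
  refine ⟨Q * P, P' * Q', ?_, ?_, ?_⟩
  · rw [Matrix.mul_assoc, ← Matrix.mul_assoc P, h1, Matrix.one_mul, h3]
  · rw [Matrix.mul_assoc, ← Matrix.mul_assoc Q', h4, Matrix.one_mul, h2]
  · simp only [Matrix.transpose_mul, Matrix.mul_assoc]

theorem Cong.map {E : Type*} [Field E] {A : Matrix ι ι F} {B : Matrix κ κ F} (h : Cong A B)
    (f : F →+* E) : Cong (A.map f) (B.map f) := by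
  obtain ⟨P, P', h1, h2, rfl⟩ := h
  refine ⟨P.map f, P'.map f, ?_, ?_, ?_⟩
  · rw [← Matrix.map_mul, h1, Matrix.map_one _ (map_zero f) (map_one f)]
  · rw [← Matrix.map_mul, h2, Matrix.map_one _ (map_zero f) (map_one f)]
  · rw [Matrix.map_mul, Matrix.map_mul, Matrix.transpose_map]

theorem Cong.submatrix (A : Matrix κ κ F) (e : ι ≃ κ) : Cong (A.submatrix e e) A := by
  refine ⟨(1 : Matrix κ κ F).submatrix id e, (1 : Matrix κ κ F).submatrix e id, ?_, ?_, ?_⟩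
  · ext i j
    rw [Matrix.mul_apply]
    refine (e.sum_comp (fun k => (1 : Matrix κ κ F) i k * (1 : Matrix κ κ F) k j)).trans ?_
    rw [← Matrix.mul_apply, Matrix.one_mul]
  · ext i j
    simp [Matrix.mul_apply, Matrix.one_apply]
  · ext i j
    simp [Matrix.mul_apply, Matrix.one_apply]

theorem Cong.dsum {A : Matrix ι ι F} {B : Matrix κ κ F} {A' : Matrix ι' ι' F}
    {B' : Matrix κ' κ' F} (h : Cong A A') (h' : Cong B B') : Cong (dsum A B) (dsum A' B') := by
  obtain ⟨P, P', h1, h2, rfl⟩ := h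
  obtain ⟨Q, Q', h3, h4, rfl⟩ := h'
  refine ⟨Matrix.fromBlocks P 0 0 Q, Matrix.fromBlocks P' 0 0 Q', ?_, ?_, ?_⟩
  · simp [Matrix.fromBlocks_multiply, h1, h3]
  · simp [Matrix.fromBlocks_multiply, h2, h4]
  · simp [_root_.dsum, Matrix.fromBlocks_multiply, Matrix.fromBlocks_transpose]

theorem Cong.smul {A : Matrix ι ι F} {B : Matrix κ κ F} (h : Cong A B) (c : F) :
    Cong (c • A) (c • B) := by
  obtain ⟨P, P', h1, h2, rfl⟩ := h
  exact ⟨P, P', h1, h2, by simp⟩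

theorem Cong.hasZero {A : Matrix ι ι F} {B : Matrix κ κ F} (h : Cong A B) (hA : HasZero A) :
    HasZero B := by
  obtain ⟨P, P', h1, h2, rfl⟩ := h
  obtain ⟨v, hv, h⟩ := hA
  refine ⟨P.mulVec v, fun h0 => hv ?_, by rw [← h, qval_transpose_mul_mul]⟩
  rw [← Matrix.one_mulVec v, ← h2, ← Matrix.mulVec_mulVec, h0, Matrix.mulVec_zero]

theorem Cong.hasZero_iff {A : Matrix ι ι F} {B : Matrix κ κ F} (h : Cong A B) :
    HasZero A ↔ HasZero B := ⟨h.hasZero, h.symm.hasZero⟩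

theorem Cong.dsum_assoc (A : Matrix ι ι F) (B : Matrix κ κ F) (D : Matrix τ τ F) :
    Cong (_root_.dsum (_root_.dsum A B) D) (_root_.dsum A (_root_.dsum B D)) := by
  convert Cong.submatrix (_root_.dsum A (_root_.dsum B D)) (Equiv.sumAssoc ι κ τ)
  ext ((i | i) | i) ((j | j) | j) <;> rfl

theorem Sim.sq (A : Matrix ι ι F) (c : F) : Sim A (c ^ 2) :=
  ⟨c • 1, c • 1, by simp [smul_smul, pow_two], by simp [smul_smul, pow_two], by simp, by simp⟩

theorem Sim.dsum_diag {A : Matrix ι ι F} {l : F} (h : Sim A l) (c : F) :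
    Sim (dsum A (c • A)) l := by
  obtain ⟨N, N', h1, h2, h3, h4⟩ := h
  refine ⟨dsum N N, dsum N' N', ?_⟩
  simp [dsum, Matrix.fromBlocks_multiply, Matrix.fromBlocks_transpose, h1, h2, h3, h4.symm,
    Matrix.fromBlocks_smul, smul_comm l c]

theorem Sim.dsum_swap (A : Matrix ι ι F) (c : F) : Sim (dsum A (c • A)) c := by
  refine ⟨Matrix.fromBlocks 0 (c • 1) 1 0, Matrix.fromBlocks 0 (c • 1) 1 0, ?_⟩
  simp [dsum, Matrix.fromBlocks_multiply, Matrix.fromBlocks_transpose, Matrix.fromBlocks_smul]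

theorem Sim.dsum_one_add {A : Matrix ι ι F} {l : F} (h : Sim A l) (c : F) :
    Sim (dsum A (c • A)) (1 + c * l) := by
  obtain ⟨N, N', h1, h2, h3, h4⟩ := h
  refine ⟨Matrix.fromBlocks 1 (-c • N) N' 1, Matrix.fromBlocks 1 (c • N) (-N') 1, ?_⟩
  simp [dsum, Matrix.fromBlocks_multiply, Matrix.fromBlocks_transpose, Matrix.fromBlocks_smul,
    h1, h2, h3, h4.symm, smul_smul, add_smul]
  rw [Matrix.fromBlocks_add, add_zero, add_comm (c • A), mul_comm (c * l) c]

theorem IsRound.dsum_smul {A : Matrix ι ι F} (h : IsRound A) (c : F) :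
    IsRound (dsum A (c • A)) := by
  intro u
  rw [qval_dsum, qval_smul]
  set p := qval A (u ∘ Sum.inl) with hp
  set r := qval A (u ∘ Sum.inr) with hr
  have h1 : Sim A p := h _
  have h2 : Sim A r := h _
  by_cases h0 : p = 0
  · rw [h0, zero_add]
    exact (Sim.dsum_swap A c).mul (h2.dsum_diag c)
  · have : p + c * r = p * (1 + c * (r * p * (p⁻¹) ^ 2)) := by field_simp
    rw [this]
    exact (h1.dsum_diag c).mul (((h2.mul h1).mul (Sim.sq A p⁻¹)).dsum_one_add c)

end forms

section pfister
variable {F : Type*} [Field F] {n : ℕ}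

theorem pfMatrix_cons (d : F) (a : Fin n → F) :
    pfMatrix (Fin.cons d a : Fin (n + 1) → F) = (dsum (pfMatrix a) (-d • pfMatrix a)).submatrix
      ((Fin.consEquiv fun _ => Bool).symm.trans (Equiv.boolProdEquivSum _))
      ((Fin.consEquiv fun _ => Bool).symm.trans (Equiv.boolProdEquivSum _)) := by
  rw [dsum, pfMatrix, pfMatrix, ← Matrix.diagonal_smul, Matrix.fromBlocks_diagonal,
    Matrix.submatrix_diagonal_equiv]
  congr 1
  funext b
  rw [Fin.prod_univ_succ]
  cases h : b 0
  · simp [Equiv.boolProdEquivSum, h, Fin.tail]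
    rfl
  · simp [Equiv.boolProdEquivSum, h, Fin.tail]
    exact Or.inl rfl

theorem isRound_pfMatrix (a : Fin n → F) : IsRound (pfMatrix a) := by
  induction n with
  | zero =>
    intro u
    have h : pfMatrix a = 1 := by simp [pfMatrix]
    have : qval (pfMatrix a) u = u default ^ 2 := by
      rw [h, qval, Matrix.one_mulVec, dotProduct, Fintype.sum_unique, sq]
      exact congrArg (fun b => u b * u b) (Subsingleton.elim _ _)
    rw [this]
    exact Sim.sq _ _
  | succ n ih =>
    rw [← Fin.cons_self_tail a, pfMatrix_cons]
    exact ((ih _).dsum_smul _).submatrix _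

theorem cong_pfMatrix_cons (d : F) (a : Fin n → F) :
    Cong (pfMatrix (Fin.cons d a : Fin (n + 1) → F)) (dsum (pfMatrix a) (-d • pfMatrix a)) := by
  rw [pfMatrix_cons]
  exact Cong.submatrix _ _

theorem exists_cong_pfMatrix (a : Fin n → F) :
    ∃ T : Matrix {b : Fin n → Bool // ¬ b = fun _ => false} _ F, T.IsSymm ∧
      Cong (pfMatrix a) (dsum (Matrix.diagonal fun _ : Unit => 1) T) := by
  let w : (Fin n → Bool) → F := fun b => ∏ i, if b i then -a i else 1
  let e : Unit ⊕ {b : Fin n → Bool // ¬ b = fun _ => false} ≃ (Fin n → Bool) :=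
    (Equiv.sumCongr (Equiv.ofUnique _ _) (Equiv.refl _)).trans
      (Equiv.sumCompl fun b => b = fun _ => false)
  refine ⟨Matrix.diagonal fun b => w b, Matrix.isSymm_diagonal _, ?_⟩
  have : dsum (Matrix.diagonal fun _ : Unit => (1 : F))
      (Matrix.diagonal fun b : {b : Fin n → Bool // ¬ b = fun _ => false} => w b) =
      (pfMatrix a).submatrix e e := by
    rw [dsum, Matrix.fromBlocks_diagonal, pfMatrix, Matrix.submatrix_diagonal_equiv]
    congr 1
    funext b
    rcases b with b | b
    · have : e (Sum.inl b) = fun _ => false := by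
        exact (Equiv.ofUnique Unit {b : Fin n → Bool // b = fun _ => false} b).2
      simp [this]
    · rfl
  rw [this]
  exact (Cong.submatrix _ _).symm

theorem isIsotropic_pfisterForm_iff (a : Fin n → F) :
    (PfisterForm a).IsIsotropic ↔ HasZero (pfMatrix a) := by
  let e : (Fin n → Bool) ≃ Finset (Fin n) :=
    { toFun := fun b => Finset.univ.filter fun i => b i
      invFun := fun S i => decide (i ∈ S)
      left_inv := fun b => by ext i; simp
      right_inv := fun S => by ext i; simp }
  have key : ∀ v : Finset (Fin n) → F, PfisterForm a v = qval (pfMatrix a) (v ∘ e) := by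
    intro v
    rw [PfisterForm, QuadraticMap.weightedSumSquares_apply, ← e.sum_comp]
    simp only [qval, pfMatrix, dotProduct, Matrix.mulVec_diagonal]
    refine Finset.sum_congr rfl fun b _ => ?_
    rw [show (∏ i ∈ e b, -a i) = ∏ i, if b i then -a i else 1 from Finset.prod_filter _ _]
    simp only [smul_eq_mul, Function.comp]
    ring
  constructor
  · rintro ⟨v, hv, h⟩
    refine ⟨v ∘ e, fun h0 => hv ?_, by rw [← key, h]⟩
    funext S
    simpa using congrFun h0 (e.symm S)
  · rintro ⟨v, hv, h⟩
    refine ⟨v ∘ e.symm, fun h0 => hv ?_, ?_⟩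
    · funext b
      simpa using congrFun h0 (e b)
    · rw [key]
      convert h using 2
      funext b
      simp

end pfister

section shear
variable {ι κ F : Type*} [Fintype ι] [Fintype κ] [DecidableEq ι] [DecidableEq κ] [Field F]

theorem cong_shear (A : Matrix ι ι F) (D : Matrix κ κ F) (Y : Matrix ι κ F) :
    Cong (Matrix.fromBlocks A (A * Y) (Y.transpose * A) (Y.transpose * A * Y + D)) (dsum A D) := by
  refine ⟨Matrix.fromBlocks 1 Y 0 1, Matrix.fromBlocks 1 (-Y) 0 1, ?_, ?_, ?_⟩ <;>
  simp [dsum, Matrix.fromBlocks_multiply, Matrix.fromBlocks_transpose]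

theorem cong_dsum_neg (s : Matrix ι ι F) (hs : s.IsSymm) {c : F} (hc : c ≠ 0) (y : ι → F) :
    ∃ t : Matrix ι ι F, t.IsSymm ∧
      Cong (dsum s (Matrix.diagonal fun _ : Unit => -(c + qval s y)))
        (dsum (Matrix.diagonal fun _ : Unit => -c) t) := by
  let Y : Matrix ι Unit F := Matrix.of fun i _ => y i
  let u : ι → F := s.mulVec y
  refine ⟨s + c⁻¹ • Matrix.vecMulVec u u, ?_, ?_⟩
  · rw [Matrix.IsSymm, Matrix.transpose_add, hs, Matrix.transpose_smul, Matrix.transpose_vecMulVec]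
  · refine (cong_shear s _ Y).symm.trans (Cong.trans ?_
      (cong_shear _ (s + c⁻¹ • Matrix.vecMulVec u u) (Matrix.of fun _ i => -(c⁻¹ * u i))))
    convert Cong.submatrix _ (Equiv.sumComm ι Unit)
    have hu : ∀ i, ∑ j, y j * s j i = u i := fun i => by
      simp only [u, Matrix.mulVec, dotProduct]
      exact Finset.sum_congr rfl fun j _ => by rw [mul_comm, hs.apply]
    ext (i | i) (j | j)
    · simp [Matrix.mul_apply, Matrix.vecMulVec_apply]
      field_simp
      ring
    · simp only [Matrix.mul_apply, Y, Matrix.fromBlocks_apply₁₂, Matrix.of_apply]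
      change u i = _
      simp [Matrix.mul_apply]
      field_simp
    · simp [Matrix.mul_apply, Y, hc, hu]
    · simp [Matrix.mul_apply, Y, hu, qval, dotProduct]
      have : ∑ j, u j * y j = ∑ j, y j * s.mulVec y j :=
        Finset.sum_congr rfl fun j _ => mul_comm _ _
      rw [this]
      ring

end shear

section generic

/-- The matrix of the quadratic form `(z, Y, X) ↦ 2 z (s X)_i`. -/
def crossMatrix {ρ F : Type*} [Field F] {l : ℕ} (s : Matrix (Fin l) (Fin l) F) (i : Fin l) :
    Matrix (Unit ⊕ (ρ ⊕ Fin l)) (Unit ⊕ (ρ ⊕ Fin l)) F :=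
  Matrix.fromBlocks 0 (Matrix.of fun _ => Sum.elim 0 fun j => 2 * s i j) 0 0

theorem crossMatrix_map {ρ F E : Type*} [Field F] [Field E] {l : ℕ}
    (s : Matrix (Fin l) (Fin l) F) (i : Fin l) (f : F →+* E) :
    (crossMatrix s i : Matrix (Unit ⊕ (ρ ⊕ Fin l)) _ F).map f = crossMatrix (s.map f) i := by
  ext (a | a | a) (b | b | b) <;> simp [crossMatrix]
  exact Or.inl (map_ofNat f 2)

theorem qval_crossMatrix {ρ F : Type*} [Field F] [Fintype ρ] {l : ℕ}
    (s : Matrix (Fin l) (Fin l) F) (i : Fin l) (v : Unit ⊕ (ρ ⊕ Fin l) → F) :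
    qval (crossMatrix s i) v =
      2 * v (Sum.inl ()) * s.mulVec (fun j => v (Sum.inr (Sum.inr j))) i := by
  simp [crossMatrix, qval, dotProduct, Matrix.mulVec, Fintype.sum_sum_type, Finset.mul_sum]
  exact Finset.sum_congr rfl fun _ _ => by ring

theorem qval_diagonal_unit {F : Type*} [Field F] (x : F) (v : Unit → F) :
    qval (Matrix.diagonal fun _ : Unit => x) v = x * v () ^ 2 := by
  rw [qval, dotProduct, Fintype.sum_unique, Matrix.mulVec_diagonal]
  change v () * (x * v ()) = _
  ring

theorem qval_add_vec {ι F : Type*} [Fintype ι] [Field F] {s : Matrix ι ι F} (hs : s.IsSymm)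
    (x y : ι → F) : qval s (x + y) = qval s x + 2 * (y ⬝ᵥ s.mulVec x) + qval s y := by
  have : x ⬝ᵥ s.mulVec y = y ⬝ᵥ s.mulVec x := by
    rw [Matrix.dotProduct_mulVec, ← Matrix.mulVec_transpose, hs, dotProduct_comm]
  simp only [qval, Matrix.mulVec_add, add_dotProduct, dotProduct_add, this]
  ring

theorem hasZero_of_hasZero_generic {E : Type u} [Field E] (h2 : (2 : E) ≠ 0) {ρ : Type*}
    [Fintype ρ] [DecidableEq ρ] {l : ℕ} {R : Matrix ρ ρ E} {s : Matrix (Fin l) (Fin l) E}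
    (hs : s.IsSymm) {c : E}
    (h : HasZero (dsum (Matrix.diagonal fun _ : Unit =>
      -(toFrac E l c + qval (s.map (toFrac E l)) (fracX E)))
        (dsum (R.map (toFrac E l)) (s.map (toFrac E l))))) :
    HasZero (dsum R s) ∨ HasZero (dsum R (Matrix.diagonal fun _ : Unit => -c)) := by
  obtain ⟨v, hv, h⟩ := h
  let w : Unit ⊕ (ρ ⊕ Fin l) → FractionRing (MvPolynomial (Fin l) E) :=
    Sum.elim (fun _ => v (Sum.inl ())) (Sum.elim (fun r => v (Sum.inr (Sum.inl r)))
      fun i => v (Sum.inr (Sum.inr i)) - v (Sum.inl ()) * fracX E i)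
  have hw : w ≠ 0 := by
    intro h0
    have h1 : v (Sum.inl ()) = 0 := congrFun h0 (Sum.inl ())
    apply hv
    funext a
    rcases a with a | a | a
    · exact h1
    · exact congrFun h0 (Sum.inr (Sum.inl a))
    · have := congrFun h0 (Sum.inr (Sum.inr a))
      simpa [w, h1] using this
  have key := OddZero.of_ratZero_generic l h2
    (B0 := dsum (Matrix.diagonal fun _ : Unit => -c) (dsum R s)) (B := crossMatrix s) (S := ∅)
    ⟨w, hw, by
      simp only [Set.image_empty, Set.mem_insert_iff, Set.mem_empty_iff_false, or_false,
        forall_eq, dsum_map, crossMatrix_map]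
      rw [qval_add, qval_sum, ← h]
      simp only [qval_smul, qval_crossMatrix, qval_dsum]
      have e1 : ((v ∘ Sum.inr) ∘ Sum.inr : Fin l → _) =
          ((w ∘ Sum.inr) ∘ Sum.inr) + v (Sum.inl ()) • fracX E := by
        funext i
        simp [w]
      rw [e1, qval_add_vec (hs.map _), qval_smul_vec]
      have e2 : (w ∘ Sum.inr) ∘ Sum.inl = (v ∘ Sum.inr) ∘ Sum.inl := rfl
      have e3 : ∀ x, qval (Matrix.diagonal fun _ : Unit => x) (w ∘ Sum.inl) =
          x * v (Sum.inl ()) ^ 2 := 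
        fun x => qval_diagonal_unit x _
      have e4 : ∀ x, qval (Matrix.diagonal fun _ : Unit => x) (v ∘ Sum.inl) =
          x * v (Sum.inl ()) ^ 2 := 
        fun x => qval_diagonal_unit x _
      rw [Matrix.diagonal_map (map_zero _), e2, e3, e4, smul_dotProduct, dotProduct,
        smul_eq_mul, Finset.mul_sum, Finset.mul_sum, map_neg]
      have e5 : ∀ i : Fin l, fracX E i * (2 * w (Sum.inl ()) *
          (s.map (toFrac E l)).mulVec (fun j => w (Sum.inr (Sum.inr j))) i) =
          2 * (v (Sum.inl ()) * (fracX E i *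
            (s.map (toFrac E l)).mulVec ((w ∘ Sum.inr) ∘ Sum.inr) i)) := by
        intro i
        change fracX E i * (2 * v (Sum.inl ()) *
          (s.map (toFrac E l)).mulVec ((w ∘ Sum.inr) ∘ Sum.inr) i) = _
        ring
      simp only [e5]
      ring⟩
  obtain ⟨E', _, f, hf, x, hx, hq⟩ := key
  have h0 := hq _ (Set.mem_insert _ _)
  have hc : ∀ i, qval ((crossMatrix s i).map f) x = 0 := fun i => hq _ (by simp)
  simp only [crossMatrix_map, qval_crossMatrix] at hc
  rw [dsum_map, dsum_map, qval_dsum, Matrix.diagonal_map (map_zero _)] at h0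
  have h2' : (2 : E') ≠ 0 := by rw [← map_ofNat f 2]; exact (map_ne_zero f).2 h2
  have hz : qval (Matrix.diagonal fun _ : Unit => f (-c)) (x ∘ Sum.inl) =
      f (-c) * x (Sum.inl ()) ^ 2 := qval_diagonal_unit _ _
  rw [hz] at h0
  by_cases hx0 : x (Sum.inl ()) = 0
  · left
    refine OddZero.hasZero ⟨E', _, f, hf, x ∘ Sum.inr, fun h1 => hx ?_, ?_⟩
    · funext a
      rcases a with a | a
      · exact hx0
      · exact congrFun h1 a
    · rintro _ rfl
      rw [dsum_map, ← h0, hx0]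
      ring
  · have hsx : (s.map f).mulVec ((x ∘ Sum.inr) ∘ Sum.inr) = 0 := by
      funext i
      exact (mul_eq_zero.1 (hc i)).resolve_left (mul_ne_zero h2' hx0)
    have hqs : qval (s.map f) ((x ∘ Sum.inr) ∘ Sum.inr) = 0 := by
      rw [qval, hsx, dotProduct_zero]
    rw [qval_dsum, hqs, add_zero] at h0
    right
    refine OddZero.hasZero ⟨E', _, f, hf, Sum.elim ((x ∘ Sum.inr) ∘ Sum.inl) (x ∘ Sum.inl),
      fun h1 => hx0 (congrFun h1 (Sum.inr ())), ?_⟩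
    rintro _ rfl
    rw [dsum_map, qval_dsum, Sum.elim_comp_inl, Sum.elim_comp_inr,
      Matrix.diagonal_map (map_zero _), hz, add_comm]
    exact h0

end generic

theorem toFrac_add_qval_ne_zero {F : Type*} [Field F] {l : ℕ} (s : Matrix (Fin l) (Fin l) F)
    {c : F} (hc : c ≠ 0) : toFrac F l c + qval (s.map (toFrac F l)) (fracX F) ≠ 0 := by
  let p : MvPolynomial (Fin l) F := MvPolynomial.C c + qval (s.map MvPolynomial.C) MvPolynomial.X
  have h : toFrac F l c + qval (s.map (toFrac F l)) (fracX F) =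
      algebraMap (MvPolynomial (Fin l) F) _ p := by
    rw [map_add, map_qval, Matrix.map_map]
    rfl
  rw [h, Ne, IsFractionRing.to_map_eq_zero_iff]
  intro hp
  have : MvPolynomial.eval (0 : Fin l → F) p = c := by
    rw [map_add, map_qval, MvPolynomial.eval_C]
    have : (MvPolynomial.eval (0 : Fin l → F)) ∘ MvPolynomial.X = 0 := by ext; simp
    rw [this, qval_zero_vec, add_zero]
  exact hc (by rw [← this, hp, map_zero])

theorem exists_cong_pfMatrix_cons {F : Type*} [Field F] {n l : ℕ} {ρ : Type*} [Fintype ρ]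
    [DecidableEq ρ] {a : Fin n → F} {R : Matrix ρ ρ F} {s : Matrix (Fin l) (Fin l) F}
    (hs : s.IsSymm) (h : Cong (pfMatrix a) (dsum R s)) {c : F} (hc : c ≠ 0) (y : Fin l → F) :
    ∃ (l' : ℕ) (s' : Matrix (Fin l') (Fin l') F), s'.IsSymm ∧
      Cong (pfMatrix (Fin.cons (c + qval s y) a : Fin (n + 1) → F))
        (dsum (dsum R (Matrix.diagonal fun _ : Unit => -c)) s') := by
  obtain ⟨T, hT, hπ⟩ := exists_cong_pfMatrix a
  obtain ⟨t, ht, hst⟩ := cong_dsum_neg s hs hc y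
  set d := c + qval s y
  let e := (Fintype.equivFin (Fin l ⊕ {b : Fin n → Bool // ¬ b = fun _ => false})).symm
  refine ⟨_, (dsum t (-d • T)).submatrix e e, ?_, ?_⟩
  · refine Matrix.IsSymm.submatrix ?_ e
    exact Matrix.IsSymm.fromBlocks ht (by simp) (hT.smul _)
  · have h1 : Cong (-d • pfMatrix a) (dsum (Matrix.diagonal fun _ : Unit => -d) (-d • T)) := by
      convert hπ.smul (-d)
      rw [dsum, dsum, Matrix.fromBlocks_smul, ← Matrix.diagonal_smul]
      simp
    refine (cong_pfMatrix_cons d a).trans ((h.dsum h1).trans ?_)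
    refine (Cong.dsum_assoc _ _ _).trans (Cong.trans ((Cong.refl R).dsum ?_)
      (Cong.dsum_assoc _ _ _).symm)
    refine (Cong.dsum_assoc _ _ _).symm.trans ((hst.dsum (.refl _)).trans ?_)
    exact (Cong.dsum_assoc _ _ _).trans ((Cong.refl _).dsum (Cong.submatrix _ e).symm)

theorem cong_diagonal_succ {F : Type*} [Field F] {j : ℕ} (c : Fin (j + 1) → F) :
    Cong (Matrix.diagonal c) (dsum (Matrix.diagonal fun _ : Unit => c 0)
      (Matrix.diagonal (Fin.tail c))) := by
  let e : Unit ⊕ Fin j ≃ Fin (j + 1) := (Equiv.sumComm _ _).trans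
    ((Equiv.optionEquivSumPUnit _).symm.trans (finSuccEquiv j).symm)
  convert (Cong.submatrix (Matrix.diagonal c) e).symm
  rw [dsum, Matrix.fromBlocks_diagonal, Matrix.submatrix_diagonal_equiv]
  congr 1
  funext i
  rcases i with i | i <;> simp [e, Fin.tail]

theorem hasZero_dsum_diagonal_succ_iff {F : Type*} [Field F] {ρ : Type*} [Fintype ρ]
    [DecidableEq ρ] (R : Matrix ρ ρ F) {j : ℕ} (c : Fin (j + 1) → F) :
    HasZero (dsum R (Matrix.diagonal c)) ↔
      HasZero (dsum (dsum R (Matrix.diagonal fun _ : Unit => c 0))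
        (Matrix.diagonal (Fin.tail c))) := by
  exact (((Cong.refl R).dsum (cong_diagonal_succ c)).trans (Cong.dsum_assoc _ _ _).symm).hasZero_iff

theorem pfisterEncodable_or (j : ℕ) {F : Type u} [Field F] (h2 : (2 : F) ≠ 0) {n : ℕ}
    (a : Fin n → F) (ha : ∀ i, a i ≠ 0) {ρ : Type} [Fintype ρ] [DecidableEq ρ] {l : ℕ}
    (R : Matrix ρ ρ F) (s : Matrix (Fin l) (Fin l) F) (hs : s.IsSymm)
    (h : Cong (pfMatrix a) (dsum R s)) (c : Fin j → F) (hc : ∀ i, c i ≠ 0) :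
    PfisterEncodable F fun _ _ f => HasZero ((pfMatrix a).map f) ∨
      HasZero ((dsum R (Matrix.diagonal fun i => -c i)).map f) := by
  induction j generalizing F n ρ l with
  | zero =>
    refine ⟨0, n, toFrac F 0 ∘ a, fun i => (map_ne_zero _).2 (ha i), fun E _ f => ?_⟩
    have h2' : (2 : E) ≠ 0 := by rw [← map_ofNat f 2]; exact (map_ne_zero f).2 h2
    have h1 : rmap f 0 ∘ toFrac F 0 ∘ a = toFrac E 0 ∘ f ∘ a := by
      funext i
      simp [rmap_toFrac]
    rw [h1, ← pfMatrix_map, ← pfMatrix_map, hasZero_toFrac_iff h2']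
    refine ⟨Or.inl, fun h3 => h3.elim id fun ⟨v, hv, h0⟩ => (h.map f).symm.hasZero ?_⟩
    rw [dsum_map] at h0 ⊢
    refine HasZero.dsum_left ⟨v ∘ Sum.inl, fun h4 => hv ?_, ?_⟩ _
    · funext i
      rcases i with i | i
      · exact congrFun h4 i
      · exact i.elim0
    · rw [← h0, qval_dsum]
      simp [qval]
  | succ j ih =>
    have h2' : (2 : FractionRing (MvPolynomial (Fin l) F)) ≠ 0 := by
      rw [← map_ofNat (toFrac F l) 2]
      exact (map_ne_zero _).2 h2
    obtain ⟨l', s', hs', hcong⟩ := exists_cong_pfMatrix_cons (a := toFrac F l ∘ a)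
      (hs.map (toFrac F l)) (R := R.map (toFrac F l))
      (by rw [← pfMatrix_map, ← dsum_map]; exact h.map _)
      ((map_ne_zero (toFrac F l)).2 (hc 0)) (fracX F)
    have ha' : ∀ i, (Fin.cons (toFrac F l (c 0) + qval (s.map (toFrac F l)) (fracX F))
        (toFrac F l ∘ a) : Fin (n + 1) → _) i ≠ 0 := by
      intro i
      cases i using Fin.cases with
      | zero => exact toFrac_add_qval_ne_zero s (hc 0)
      | succ i => exact (map_ne_zero _).2 (ha i)
    refine (ih h2' _ ha' _ s' hs' hcong (fun i => toFrac F l (c i.succ))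
      fun i => (map_ne_zero _).2 (hc _)).of_rmap fun E _ f => ?_
    have hE : (2 : E) ≠ 0 := by rw [← map_ofNat f 2]; exact (map_ne_zero f).2 h2
    have e1 : ∀ {ι : Type} (A : Matrix ι ι F),
        (A.map (toFrac F l)).map (rmap f l) = (A.map f).map (toFrac E l) := by
      intro ι A
      ext i j
      simp [rmap_toFrac]
    have e2 : (dsum (dsum (R.map (toFrac F l)) (Matrix.diagonal fun _ : Unit => -toFrac F l (c 0)))
        (Matrix.diagonal fun i => -toFrac F l (c (Fin.succ i)))).map (rmap f l) =
        ((dsum (dsum R (Matrix.diagonal fun _ : Unit => -c 0))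
          (Matrix.diagonal fun i => -c (Fin.succ i))).map f).map (toFrac E l) := by
      rw [← e1]
      refine congrArg (fun A : Matrix _ _ _ => A.map (rmap f l)) ?_
      rw [dsum_map, dsum_map, Matrix.diagonal_map (map_zero _), Matrix.diagonal_map (map_zero _)]
      simp
    have e3 : HasZero ((dsum R (Matrix.diagonal fun i => -c i)).map f) ↔
        HasZero ((dsum (dsum R (Matrix.diagonal fun _ : Unit => -c 0))
          (Matrix.diagonal fun i => -c (Fin.succ i))).map f) := by
      rw [dsum_map, Matrix.diagonal_map (map_zero _), hasZero_dsum_diagonal_succ_iff, dsum_map,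
        dsum_map, Matrix.diagonal_map (map_zero _), Matrix.diagonal_map (map_zero _)]
      rfl
    rw [e2, hasZero_toFrac_iff hE, ← e3]
    have hd : ∀ {P Q S : Prop}, (P → Q ∨ S) → (Q → P) → (P ∨ S ↔ Q ∨ S) := by tauto
    set d := toFrac F l (c 0) + qval (s.map (toFrac F l)) (fracX F) with hdef
    have hdE : rmap f l d = toFrac E l (f (c 0)) +
        qval ((s.map f).map (toFrac E l)) (fracX E) := by
      rw [hdef, map_add, rmap_toFrac, map_qval, e1]
      congr 2
      funext i
      exact rmap_fracX f i
    have hpf := (cong_pfMatrix_cons d (toFrac F l ∘ a)).map (rmap f l)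
    rw [dsum_map, ← pfMatrix_map, Matrix.map_smul' _ _ _ (map_mul (rmap f l)), e1, map_neg] at hpf
    refine hd (fun h3 => ?_) fun h3 => hpf.symm.hasZero ((h3.map _).dsum_left _)
    have hround : IsRound (((pfMatrix a).map f).map (toFrac E l)) := by
      rw [pfMatrix_map, pfMatrix_map]
      exact isRound_pfMatrix _
    rcases hround.hasZero_dsum_smul (hpf.hasZero h3) with h4 | h4
    · exact Or.inl (h4.of_toFrac hE)
    · have h5 := ((Cong.refl (Matrix.diagonal fun _ : Unit => -rmap f l d)).dsum
        ((h.map f).map (toFrac E l))).hasZero h4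
      rw [hdE, dsum_map, dsum_map] at h5
      rcases hasZero_of_hasZero_generic hE (hs.map f) h5 with h6 | h6
      · left
        rw [← dsum_map] at h6
        exact (h.map f).symm.hasZero h6
      · right
        rw [e3, dsum_map, dsum_map, Matrix.diagonal_map (map_zero _), map_neg]
        exact h6.dsum_left _

section oddDegree
attribute [local instance] MvPolynomial.algebraMvPolynomial FractionRing.liftAlgebra

theorem IsOddFiniteExt.rmap {F E : Type u} [Field F] [Field E] {f : F →+* E}
    (hf : IsOddFiniteExt F E f) (m : ℕ) :
    IsOddFiniteExt (FractionRing (MvPolynomial (Fin m) F)) (FractionRing (MvPolynomial (Fin m) E))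
      (rmap f m) := by
  let : Algebra F E := f.toAlgebra
  obtain ⟨hfin, hodd⟩ : FiniteDimensional F E ∧ Odd (Module.finrank F E) := hf
  have h := Algebra.IsAlgebraic.rank_fractionRing_mvPolynomial (R := F) (S := E) (Fin m)
  have hr : _root_.rmap f m = algebraMap (FractionRing (MvPolynomial (Fin m) F))
      (FractionRing (MvPolynomial (Fin m) E)) := by
    refine fracHom_ext ?_ fun i => ?_
    · rw [rmap_comp_toFrac]
      ext x
      rw [RingHom.comp_apply, RingHom.comp_apply, toFrac, toFrac, RingHom.comp_apply,
        RingHom.comp_apply, ← IsScalarTower.algebraMap_apply,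
        IsScalarTower.algebraMap_apply (MvPolynomial (Fin m) F) (MvPolynomial (Fin m) E)]
      exact congrArg _ (MvPolynomial.map_C _ _).symm
    · rw [rmap_fracX, fracX, fracX, ← IsScalarTower.algebraMap_apply,
        IsScalarTower.algebraMap_apply (MvPolynomial (Fin m) F) (MvPolynomial (Fin m) E)]
      exact congrArg _ (MvPolynomial.map_X _ _).symm
  rw [hr]
  have : FiniteDimensional (FractionRing (MvPolynomial (Fin m) F))
      (FractionRing (MvPolynomial (Fin m) E)) := by
    refine Module.rank_lt_aleph0_iff.1 ?_
    rw [h, Cardinal.lift_lt_aleph0]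
    exact Module.rank_lt_aleph0_iff.2 hfin
  refine IsOddFiniteExt.of_algebra _ _ ?_
  rwa [Module.finrank, h, Cardinal.toNat_lift]

end oddDegree

section single
variable {F : Type u} [Field F]

theorem pfisterEncodable_true : PfisterEncodable F fun _ _ _ => True := by
  refine ⟨0, 1, fun _ => 1, fun _ => one_ne_zero, fun E _ f => iff_true_intro ?_⟩
  refine ⟨fun _ => 1, fun h => one_ne_zero (congrFun h fun _ => false), ?_⟩
  have : ∑ b : Fin 1 → Bool, ∏ i : Fin 1, (if b i then -1 else 1 :
      FractionRing (MvPolynomial (Fin 0) E)) = 0 := by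
    rw [← (Equiv.funUnique (Fin 1) Bool).symm.sum_comp]
    simp
  simpa [qval, pfMatrix, dotProduct, Matrix.mulVec_diagonal] using this

theorem HasZero.smul_iff {ι : Type*} [Fintype ι] {A : Matrix ι ι F} {c : F} (hc : c ≠ 0) :
    HasZero (c • A) ↔ HasZero A := by
  simp only [HasZero, qval_smul, mul_eq_zero, hc, false_or]

theorem exists_cong_diagonal (h2 : (2 : F) ≠ 0) {N : ℕ} {A : Matrix (Fin N) (Fin N) F}
    (hA : A.IsSymm) : ∃ d : Fin N → F, Cong A (Matrix.diagonal d) := by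
  have : Invertible (2 : F) := invertibleOfNonzero h2
  have hB : LinearMap.IsSymm (Matrix.toBilin' A) := by
    refine ⟨fun x y => ?_⟩
    rw [RingHom.id_apply, Matrix.toBilin'_apply', Matrix.toBilin'_apply', Matrix.dotProduct_mulVec,
      ← Matrix.mulVec_transpose, hA, dotProduct_comm]
  obtain ⟨v, hv⟩ := LinearMap.BilinForm.exists_orthogonal_basis hB
  let w := v.reindex (finCongr (Module.finrank_fin_fun F))
  let b := Pi.basisFun F (Fin N)
  refine ⟨fun i => Matrix.toBilin' A (w i) (w i), Cong.symm ⟨b.toMatrix w, w.toMatrix b,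
    b.toMatrix_mul_toMatrix_flip _, w.toMatrix_mul_toMatrix_flip _, ?_⟩⟩
  have h := LinearMap.BilinForm.toMatrix_mul_basis_toMatrix b w (Matrix.toBilin' A)
  rw [LinearMap.BilinForm.toMatrix_basisFun, LinearMap.BilinForm.toMatrix'_toBilin'] at h
  rw [h]
  ext i j
  rw [LinearMap.BilinForm.toMatrix_apply, Matrix.diagonal_apply]
  split_ifs with hij
  · rw [hij]
  · have e : ∀ i, w i = v ((finCongr (Module.finrank_fin_fun F)).symm i) := fun i =>
      v.reindex_apply _ i
    rw [e, e]
    exact (hv fun h => hij ((finCongr (Module.finrank_fin_fun F)).symm.injective h)).symm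

theorem pfisterEncodable_hasZero (h2 : (2 : F) ≠ 0) {N : ℕ}
    {A : Matrix (Fin (N + 1)) (Fin (N + 1)) F} (hA : A.IsSymm) :
    PfisterEncodable F fun _ _ f => HasZero (A.map f) := by
  obtain ⟨b, hb⟩ := exists_cong_diagonal h2 hA
  by_cases h0 : ∃ i, b i = 0
  · obtain ⟨i, hi⟩ := h0
    refine pfisterEncodable_true.congr fun E _ f => (iff_true_intro ?_).symm
    refine (hb.map f).symm.hasZero (HasZero.map ⟨Pi.single i 1, by simp, ?_⟩ f)
    simp [qval, hi]
  push Not at h0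
  have h1 : Cong (pfMatrix (Fin.elim0 : Fin 0 → F))
      (dsum (Matrix.diagonal fun _ : Unit => (1 : F)) (0 : Matrix (Fin 0) (Fin 0) F)) := by
    convert (Cong.submatrix _ ((Equiv.sumEmpty Unit (Fin 0)).trans
      (Equiv.ofUnique Unit (Fin 0 → Bool)))).symm
    ext (i | i) (j | j)
    · simp [dsum, pfMatrix]
    · exact j.elim0
    · exact i.elim0
    · exact i.elim0
  refine (pfisterEncodable_or N h2 _ (fun i => i.elim0) _ _ Matrix.isSymm_zero h1
    (fun i => -(b i.succ / b 0)) fun i => neg_ne_zero.2 (div_ne_zero (h0 _) (h0 _))).congr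
    fun E _ f => ?_
  have h3 : ¬ HasZero ((pfMatrix (Fin.elim0 : Fin 0 → F)).map f) := by
    rintro ⟨v, hv, h⟩
    apply hv
    have : (v default) ^ 2 = 0 := by
      rw [← h, pfMatrix_map, qval, dotProduct, Fintype.sum_unique]
      simp only [pfMatrix, Matrix.mulVec_diagonal, sq, Finset.univ_eq_empty, Finset.prod_empty,
        one_mul]
      exact congrArg (fun b => v b * v b) (Subsingleton.elim _ _)
    funext i
    rw [Subsingleton.elim i default]
    simpa using this
  rw [or_iff_right h3, (hb.map f).hasZero_iff, ((cong_diagonal_succ b).map f).hasZero_iff,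
    ← HasZero.smul_iff
      (A := (dsum (Matrix.diagonal fun _ : Unit => b 0) (Matrix.diagonal (Fin.tail b))).map f)
      ((map_ne_zero f).2 (inv_ne_zero (h0 0))), ← Matrix.map_smul' _ _ _ (map_mul f)]
  refine Iff.of_eq (congrArg (fun B : Matrix (Unit ⊕ Fin N) _ F => HasZero (B.map f)) ?_)
  rw [dsum, dsum, Matrix.fromBlocks_smul, ← Matrix.diagonal_smul, ← Matrix.diagonal_smul]
  congr 1
  · ext i j
    simp [h0]
  · simp
  · simp
  · ext i j
    simp [Matrix.diagonal_apply, Fin.tail, div_eq_inv_mul]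

end single

section systems

theorem qval_transpose {ι R : Type*} [Fintype ι] [CommRing R] (A : Matrix ι ι R) (v : ι → R) :
    qval A.transpose v = qval A v := by
  rw [qval, Matrix.mulVec_transpose, dotProduct_comm, ← Matrix.dotProduct_mulVec, qval]

theorem pfisterEncodable_oddZero {k : Type u} [Field k] (h2 : (2 : k) ≠ 0) {N M : ℕ}
    (A : Fin (M + 1) → Matrix (Fin (N + 1)) (Fin (N + 1)) k) :
    PfisterEncodable k fun _ _ f => OddZero (Set.range fun i => (A i).map f) := by
  let Q := (A 0).map (toFrac k M) + ∑ i, fracX k i • (A (Fin.succ i)).map (toFrac k M)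
  have h2' : (2 : FractionRing (MvPolynomial (Fin M) k)) ≠ 0 := by
    rw [← map_ofNat (toFrac k M) 2]
    exact (map_ne_zero _).2 h2
  have hsymm : ((2 : FractionRing (MvPolynomial (Fin M) k))⁻¹ • (Q + Q.transpose)).IsSymm :=
    (Matrix.isSymm_add_transpose_self Q).smul _
  refine (pfisterEncodable_hasZero h2' hsymm).of_rmap fun L _ f => ?_
  have hL : (2 : L) ≠ 0 := by rw [← map_ofNat f 2]; exact (map_ne_zero f).2 h2
  have h1 : HasZero (((2 : FractionRing (MvPolynomial (Fin M) k))⁻¹ •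
      (Q + Q.transpose)).map (rmap f M)) ↔ HasZero (Q.map (rmap f M)) := by
    have h2'' : (2 : FractionRing (MvPolynomial (Fin M) L)) ≠ 0 := by
      rw [← map_ofNat (toFrac L M) 2]
      exact (map_ne_zero _).2 hL
    refine exists_congr fun v => and_congr_right fun _ => ?_
    rw [Matrix.map_smul' _ _ _ (map_mul (rmap f M)), Matrix.map_add _ (map_add (rmap f M)),
      Matrix.transpose_map, qval_smul, qval_add, qval_transpose, map_inv₀, map_ofNat,
      ← two_mul, inv_mul_cancel_left₀ h2'']
  have hQ : Q.map (rmap f M) = ((A 0).map f).map (toFrac L M) +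
      ∑ i, fracX L i • ((A (Fin.succ i)).map f).map (toFrac L M) := by
    ext i j
    simp [Q, rmap_toFrac, rmap_fracX, Matrix.sum_apply]
  rw [h1, hQ]
  constructor
  · rintro ⟨v, hv, h⟩
    refine (OddZero.of_ratZero_generic M hL (B0 := (A 0).map f)
      (B := fun i => (A (Fin.succ i)).map f) (S := ∅) ⟨v, hv, ?_⟩).mono ?_
    · simpa using h
    · rintro _ ⟨i, rfl⟩
      cases i using Fin.cases <;> simp
  · rintro ⟨E, _, g, hg, v, hv, h⟩
    refine OddZero.hasZero ⟨_, _, _, hg.rmap M, toFrac E M ∘ v, ?_, ?_⟩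
    · intro h0
      apply hv
      funext i
      exact (toFrac E M).injective (by simpa using congrFun h0 i)
    · rintro _ rfl
      have e : ∀ B : Matrix (Fin (N + 1)) (Fin (N + 1)) L,
          (B.map (toFrac L M)).map (rmap g M) = (B.map g).map (toFrac E M) := by
        intro B
        ext i j
        simp [rmap_toFrac]
      have h' : ∀ i, qval (((A i).map f).map g) v = 0 := fun i => h _ ⟨i, rfl⟩
      have : (((A 0).map f).map (toFrac L M) +
          ∑ i, fracX L i • ((A (Fin.succ i)).map f).map (toFrac L M)).map (rmap g M) =
          (((A 0).map f).map g).map (toFrac E M) +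
          ∑ i, fracX E i • (((A (Fin.succ i)).map f).map g).map (toFrac E M) := by
        ext i j
        simp [rmap_toFrac, rmap_fracX, Matrix.sum_apply]
      rw [this, qval_add, qval_sum, ← map_qval, h', map_zero, zero_add]
      refine Finset.sum_eq_zero fun i _ => ?_
      rw [qval_smul, ← map_qval, h', map_zero, mul_zero]

theorem mapAlong_apply {k E : Type*} [Field k] [Field E] (f : k →+* E) {n : ℕ}
    (q : QuadraticForm k (Fin n → k)) (v : Fin n → E) :
    q.mapAlong f v = qval ((Matrix.of fun i j =>
      if i = j then q (Pi.single i 1)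
      else if i < j then QuadraticMap.polar q (Pi.single i 1) (Pi.single j 1) else 0).map f) v := by
  rw [QuadraticForm.mapAlong, Matrix.toQuadraticMap', Matrix.toQuadraticForm',
    LinearMap.BilinMap.toQuadraticMap_apply, Matrix.toLinearMap₂'_apply', qval]
  congr 2
  ext i j
  simp only [Matrix.of_apply, Matrix.map_apply]
  split_ifs <;> simp

end systems

/-- **Main Theorem (linear-system form).** For quadratic forms `q_0, …, q_M` on `k^{N+1}`
there are `m`, `n` and units `a_1, …, a_n` of `k(x_1, …, x_m)` such that for every field
extension `L/k`: the Pfister form `⟨⟨a_1, …, a_n⟩⟩` is isotropic over `L(x_1, …, x_m)` iff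
there is a finite extension `L'/L` of odd degree and a nonzero vector `v ∈ L'^{N+1}` with
`q_i(v) = 0` for all `i`. -/
theorem main_theorem_linear_system {k : Type u} [Field k] (hk : ringChar k ≠ 2)
    {N M : ℕ} (q : Fin (M + 1) → QuadraticForm k (Fin (N + 1) → k)) :
    ∃ (m n : ℕ) (a : Fin n → (FractionRing (MvPolynomial (Fin m) k))ˣ),
      ∀ (L : Type u) [Field L] [Algebra k L],
        (PfisterForm fun i => transMap k L m (a i)).IsIsotropic ↔
          ∃ (L' : Type u) (_ : Field L') (f : L →+* L'),
            IsOddFiniteExt L L' f ∧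
            ∃ v : Fin (N + 1) → L', v ≠ 0 ∧
              ∀ i, ((q i).mapAlong (f.comp (algebraMap k L))) v = 0 := by
  have h2 : (2 : k) ≠ 0 := Ring.two_ne_zero hk
  obtain ⟨m, n, a, ha, h⟩ := pfisterEncodable_oddZero h2 fun i => Matrix.of fun j l =>
    if j = l then q i (Pi.single j 1)
    else if j < l then QuadraticMap.polar (q i) (Pi.single j 1) (Pi.single l 1) else 0
  refine ⟨m, n, fun i => Units.mk0 (a i) (ha i), fun L _ _ => ?_⟩
  have hr : rmap (algebraMap k L) m = transMap k L m := by
    rw [rmap]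
    congr
  rw [isIsotropic_pfisterForm_iff]
  refine (hr ▸ h L (algebraMap k L)).trans ?_
  simp only [OddZero, mapAlong_apply, Set.forall_mem_range, Matrix.map_map, RingHom.coe_comp]
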